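/- Let n ≥ 2, p > 0, and let f : B → ℝⁿ \ {0} be a K-quasiregular mapping in the Miniowitz class (Min) with constants C₀, α, satisfying the multiplicity condition (M) with exponent 0 ≤ a < n−1 and constant C₁; let f̃ denote its non-tangential limit function (existing σ-a.e.). If f̃ ∈ L^p(S^{n−1}, σ), then lim_{r→1⁻} ∫_{S^{n−1}} |f(rω) − f̃(ω)|^p dσ(ω) = 0. -/

import Mathlib

open MeasureTheory Metric Set Filter
open scoped ENNReal NNReal Topology Classical

noncomputable section

abbrev Vec (n : ℕ) := EuclideanSpace ℝ (Fin n)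

/-- The open unit ball in `ℝⁿ`. -/
def unitBall (n : ℕ) : Set (Vec n) := Metric.ball 0 1

/-- The unit sphere `S^{n-1}` in `ℝⁿ`. -/
def unitSphere (n : ℕ) : Set (Vec n) := Metric.sphere 0 1

/-- Surface measure on the unit sphere, modelled by `(n-1)`-dimensional
Hausdorff measure restricted to the sphere. -/
def sphMeasure (n : ℕ) : Measure (Vec n) := (μH[(n : ℝ) - 1]).restrict (unitSphere n)

/-- `f` is `K`-quasiregular on the unit ball. -/
def IsQR (n : ℕ) (K : ℝ) (f : Vec n → Vec n) : Prop :=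
  ContinuousOn f (unitBall n) ∧
  (∀ x ∈ unitBall n, DifferentiableAt ℝ f x) ∧
  (∀ᵐ x ∂(volume.restrict (unitBall n)),
    ‖fderiv ℝ f x‖ ^ n ≤ K * (fderiv ℝ f x).det)

/-- The conformal automorphism `T_x` of the unit ball (with `T_0 = id`). -/
def mobiusT (n : ℕ) (x : Vec n) (y : Vec n) : Vec n :=
  if x = 0 then y
  else (‖x‖ ^ 2 * ‖y - (‖x‖ ^ 2)⁻¹ • x‖ ^ 2)⁻¹ •
    ((1 - ‖x‖ ^ 2) • (y - x) - ‖y - x‖ ^ 2 • x)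

/-- The Miniowitz class (Min) with constants `C₀, α`. -/
def InMiniowitz (n : ℕ) (C₀ α : ℝ) (f : Vec n → Vec n) : Prop :=
  ∀ x ∈ unitBall n, ∀ y ∈ unitBall n,
    C₀⁻¹ * ((1 - ‖y‖) / (1 + ‖y‖)) ^ α ≤ ‖f (mobiusT n (-x) y)‖ / ‖f (mobiusT n (-x) 0)‖ ∧
    ‖f (mobiusT n (-x) y)‖ / ‖f (mobiusT n (-x) 0)‖ ≤ C₀ * ((1 + ‖y‖) / (1 - ‖y‖)) ^ α

/-- The multiplicity condition (M) with exponent `a` and constant `C₁`. -/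
def MultCond (n : ℕ) (a C₁ : ℝ) (f : Vec n → Vec n) : Prop :=
  ∀ x ∈ unitBall n, ∀ r : ℝ, 0 < r → r < 1 → ∀ y : Vec n,
    (({z ∈ Metric.ball (0 : Vec n) r | f (mobiusT n (-x) z) = y}).encard : ℝ≥0∞) ≤
      ENNReal.ofReal (C₁ / (1 - r) ^ a)

/-- The non-tangential region `Γ(ω)` with aperture parameter `κ`. -/
def ntRegion (n : ℕ) (κ : ℝ) (ω : Vec n) : Set (Vec n) :=
  {x ∈ unitBall n | ‖x - ω‖ < (1 + κ) * (1 - ‖x‖)}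

/-- The non-tangential maximal function `f*`. -/
def ntMax (n : ℕ) (κ : ℝ) (f : Vec n → Vec n) (ω : Vec n) : ℝ≥0∞ :=
  ⨆ x ∈ ntRegion n κ ω, ENNReal.ofReal ‖f x‖

/-- `f` has the non-tangential limit `L` at `ω`. -/
def HasNTLimit (n : ℕ) (κ : ℝ) (f : Vec n → Vec n) (ω L : Vec n) : Prop :=
  Filter.Tendsto f (𝓝[ntRegion n κ ω] ω) (𝓝 L)

/-- The `p`-th mean of `f` on the sphere of radius `r`. -/
def hardyMean (n : ℕ) (p : ℝ) (f : Vec n → Vec n) (r : ℝ) : ℝ≥0∞ :=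
  (sphMeasure n (unitSphere n))⁻¹ *
    ∫⁻ ω, ENNReal.ofReal (‖f (r • ω)‖ ^ p) ∂(sphMeasure n)

/-- The Hardy `H^p` norm of `f` on the unit ball. -/
def hardyNorm (n : ℕ) (p : ℝ) (f : Vec n → Vec n) : ℝ≥0∞ :=
  (⨆ r ∈ Set.Ioo (0 : ℝ) 1, hardyMean n p f r) ^ (1 / p)

/-- `f` belongs to the Hardy space `H^p`. -/
def MemHp (n : ℕ) (p : ℝ) (f : Vec n → Vec n) : Prop := hardyNorm n p f < ⊤

/-- The `L^p(σ)` norm of a boundary function on the unit sphere. -/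
def lpSphere (n : ℕ) (p : ℝ) (g : Vec n → Vec n) : ℝ≥0∞ :=
  (∫⁻ ω, ENNReal.ofReal (‖g ω‖ ^ p) ∂(sphMeasure n)) ^ (1 / p)

/-- The `L^p(σ)` norm of the non-tangential maximal function `f*`. -/
def ntMaxLp (n : ℕ) (κ p : ℝ) (f : Vec n → Vec n) : ℝ≥0∞ :=
  (∫⁻ ω, (ntMax n κ f ω) ^ p ∂(sphMeasure n)) ^ (1 / p)

/-- `μ` is a Carleson measure on the unit ball with constant `c`. -/
def IsCarleson (n : ℕ) (c : ℝ) (μ : Measure (Vec n)) : Prop :=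
  ∀ ω ∈ unitSphere n, ∀ r : ℝ, 0 < r →
    μ (unitBall n ∩ Metric.ball ω r) ≤ ENNReal.ofReal c * ENNReal.ofReal r ^ ((n : ℝ) - 1)

/-- `μ` is an `α`-Carleson measure on the unit ball with constant `γ`. -/
def IsAlphaCarleson (n : ℕ) (α γ : ℝ) (μ : Measure (Vec n)) : Prop :=
  ∀ ω ∈ unitSphere n, ∀ r : ℝ, 0 < r →
    μ (unitBall n ∩ Metric.ball ω r) ≤
      ENNReal.ofReal γ * ENNReal.ofReal r ^ (α * ((n : ℝ) - 1))

/-- An expanding comparison on `s` bounds the Hausdorff measure of `s` by that of its image. -/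
lemma hausdorffMeasure_le_image {X Y : Type*} [MetricSpace X] [MeasurableSpace X] [BorelSpace X]
    [MetricSpace Y] [MeasurableSpace Y] [BorelSpace Y] (L : ℝ≥0) {d : ℝ} (hd : 0 ≤ d)
    (φ : X → Y) (s : Set X) (h : ∀ x ∈ s, ∀ y ∈ s, dist x y ≤ L * dist (φ x) (φ y)) :
    μH[d] s ≤ (L : ℝ≥0∞) ^ d * μH[d] (φ '' s) := by
  rcases s.eq_empty_or_nonempty with rfl | ⟨x0, hx0⟩
  · simp
  have : Nonempty X := ⟨x0⟩
  have hinj : InjOn φ s := by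
    intro x hx y hy hxy
    have := h x hx y hy
    rw [hxy, dist_self, mul_zero] at this
    exact dist_le_zero.mp this
  have hl : LipschitzOnWith L (Function.invFunOn φ s) (φ '' s) := by
    refine LipschitzOnWith.of_dist_le_mul ?_
    rintro _ ⟨x, hx, rfl⟩ _ ⟨y, hy, rfl⟩
    rw [hinj.leftInvOn_invFunOn hx, hinj.leftInvOn_invFunOn hy]
    exact h x hx y hy
  have := hl.hausdorffMeasure_image_le hd
  rwa [hinj.leftInvOn_invFunOn.image_image] at this

/-- The pieces of the sphere on which a given signed coordinate is bounded below. -/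
def spherePiece (n : ℕ) (i : Fin n) (ε : ℝ) : Set (Vec n) :=
  {ω ∈ unitSphere n | 1 / (n : ℝ) ≤ ε * ω i}

lemma unitSphere_subset_pieces (n : ℕ) (hn : 2 ≤ n) :
    unitSphere n ⊆ ⋃ i : Fin n, (spherePiece n i 1 ∪ spherePiece n i (-1)) := by
  intro ω hω
  by_contra hcon
  have hlt : ∀ i, |ω i| < 1 / (n : ℝ) := by
    intro i
    by_contra hi
    push Not at hi
    apply hcon
    refine mem_iUnion.mpr ⟨i, ?_⟩
    rcases abs_cases (ω i) with ⟨h, _⟩ | ⟨h, _⟩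
    · exact Or.inl ⟨hω, by linarith⟩
    · exact Or.inr ⟨hω, by linarith⟩
  have hn' : (2 : ℝ) ≤ n := by exact_mod_cast hn
  have hnorm : ‖ω‖ = 1 := by simpa [unitSphere] using hω
  have h1 : ∑ i, (ω i) ^ 2 = 1 := by
    have := EuclideanSpace.norm_sq_eq ω
    rw [hnorm] at this
    simpa using this.symm
  have h2 : ∑ i : Fin n, (ω i) ^ 2 ≤ ∑ _i : Fin n, (1 / (n : ℝ)) ^ 2 := by
    refine Finset.sum_le_sum fun i _ => ?_
    rw [← sq_abs]
    exact pow_le_pow_left₀ (abs_nonneg _) (hlt i).le 2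
  rw [h1] at h2
  simp only [Finset.sum_const, Finset.card_univ, Fintype.card_fin, nsmul_eq_mul] at h2
  have h3 : (n : ℝ) * (1 / n) ^ 2 = 1 / n := by field_simp
  rw [h3, le_div_iff₀ (by linarith)] at h2
  linarith

/-- The map forgetting the `i`-th coordinate, into the sup-normed space. -/
def dropCoord (n : ℕ) (i : Fin n) (v : Vec n) : {j : Fin n // j ≠ i} → ℝ := fun j => v j

lemma euclidean_norm_le_sum {n : ℕ} (v : Vec n) {b : ℝ} (hb : 0 ≤ b) (h : ∀ i, |v i| ≤ b) :
    ‖v‖ ≤ n * b := by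
  rw [EuclideanSpace.norm_eq]
  refine Real.sqrt_le_iff.mpr ⟨by positivity, ?_⟩
  calc ∑ i, ‖v i‖ ^ 2 ≤ ∑ _i : Fin n, b ^ 2 := by
        refine Finset.sum_le_sum fun i _ => ?_
        exact pow_le_pow_left₀ (norm_nonneg _) (h i) 2
    _ = n * b ^ 2 := by simp
    _ ≤ (n * b) ^ 2 := by
        rw [mul_pow]
        refine mul_le_mul_of_nonneg_right ?_ (sq_nonneg b)
        have : n ≤ n ^ 2 := Nat.le_self_pow two_ne_zero n
        exact_mod_cast this

lemma spherePiece_dist_le (n : ℕ) (hn : 2 ≤ n) (i : Fin n) (ε : ℝ) (hε : |ε| = 1)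
    (x : Vec n) (hx : x ∈ spherePiece n i ε) (y : Vec n) (hy : y ∈ spherePiece n i ε) :
    dist x y ≤ (n ^ 3 : ℝ) * dist (dropCoord n i x) (dropCoord n i y) := by
  have hn' : (2 : ℝ) ≤ n := by exact_mod_cast hn
  set δ := dist (dropCoord n i x) (dropCoord n i y) with hδ
  have hδ0 : 0 ≤ δ := dist_nonneg
  have hco : ∀ j, j ≠ i → |x j - y j| ≤ δ := by
    intro j hj
    have := dist_le_pi_dist (dropCoord n i x) (dropCoord n i y) ⟨j, hj⟩
    simpa [dropCoord, Real.dist_eq] using this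
  have hxn : ‖x‖ = 1 := by simpa [unitSphere] using hx.1
  have hyn : ‖y‖ = 1 := by simpa [unitSphere] using hy.1
  have hle : ∀ (z : Vec n), ‖z‖ = 1 → ∀ j, |z j| ≤ 1 := by
    intro z hz j
    have := PiLp.norm_apply_le z j
    rwa [hz, Real.norm_eq_abs] at this
  have hs : ∀ z : Vec n, ‖z‖ = 1 → (z i) ^ 2 + ∑ j ∈ Finset.univ.erase i, (z j) ^ 2 = 1 := by
    intro z hz
    have := EuclideanSpace.norm_sq_eq z
    rw [hz] at this
    rw [Finset.add_sum_erase _ (fun j => (z j) ^ 2) (Finset.mem_univ i)]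
    simpa using this.symm
  have hsum : |∑ j ∈ Finset.univ.erase i, ((y j) ^ 2 - (x j) ^ 2)| ≤ n * (2 * δ) := by
    refine (Finset.abs_sum_le_sum_abs _ _).trans ?_
    calc ∑ j ∈ Finset.univ.erase i, |(y j) ^ 2 - (x j) ^ 2|
        ≤ ∑ _j ∈ Finset.univ.erase i, 2 * δ := by
          refine Finset.sum_le_sum fun j hj => ?_
          have e : (y j) ^ 2 - (x j) ^ 2 = -((x j + y j) * (x j - y j)) := by ring
          rw [e, abs_neg, abs_mul]
          refine mul_le_mul ?_ (hco j (Finset.ne_of_mem_erase hj)) (abs_nonneg _) (by norm_num)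
          refine (abs_add_le _ _).trans ?_
          linarith [hle x hxn j, hle y hyn j]
      _ ≤ ∑ _j : Fin n, 2 * δ :=
          Finset.sum_le_sum_of_subset_of_nonneg (Finset.subset_univ _) fun _ _ _ => by positivity
      _ = n * (2 * δ) := by simp
  have hprod : (x i - y i) * (x i + y i) =
      ∑ j ∈ Finset.univ.erase i, ((y j) ^ 2 - (x j) ^ 2) := by
    rw [Finset.sum_sub_distrib]
    linarith [hs x hxn, hs y hyn]
  have hlow : 2 / (n : ℝ) ≤ |x i + y i| := by
    have : ε * x i + ε * y i ≤ |ε * (x i + y i)| := by rw [← mul_add]; exact le_abs_self _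
    rw [abs_mul, hε, one_mul] at this
    have e : 2 / (n : ℝ) = 1 / n + 1 / n := by ring
    linarith [hx.2, hy.2]
  have hi : |x i - y i| ≤ n ^ 2 * δ := by
    have h1 : |x i - y i| * (2 / n) ≤ n * (2 * δ) := by
      calc |x i - y i| * (2 / n) ≤ |x i - y i| * |x i + y i| := by gcongr
        _ ≤ n * (2 * δ) := by rw [← abs_mul, hprod]; exact hsum
    rw [mul_div_assoc', div_le_iff₀ (by linarith)] at h1
    nlinarith
  rw [dist_eq_norm]
  have : ‖x - y‖ ≤ n * (n ^ 2 * δ) := by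
    refine euclidean_norm_le_sum _ (by positivity) fun j => ?_
    by_cases hj : j = i
    · subst hj; simpa using hi
    · refine (by simpa using hco j hj : |(x - y) j| ≤ δ).trans ?_
      have : (1 : ℝ) ≤ n ^ 2 := by nlinarith
      nlinarith
  calc ‖x - y‖ ≤ _ := this
    _ = _ := by ring

/-- Upper Ahlfors regularity of the surface measure. -/
lemma sphMeasure_closedBall_le (n : ℕ) (hn : 2 ≤ n) :
    ∃ A : ℝ, 0 < A ∧ ∀ (z : Vec n) (r : ℝ), 0 ≤ r →
      sphMeasure n (closedBall z r) ≤ ENNReal.ofReal (A * r ^ (n - 1)) := by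
  have hn' : (0 : ℝ) < n := by positivity
  have hcast : ((n : ℝ) - 1) = ((n - 1 : ℕ) : ℝ) := by
    rw [Nat.cast_sub (by lia)]; simp
  refine ⟨n * 2 * ((n : ℝ) ^ 3) ^ (n - 1) * 2 ^ (n - 1), by positivity, fun z r hr => ?_⟩
  have hpiece : ∀ (i : Fin n) (ε : ℝ), |ε| = 1 → μH[(n : ℝ) - 1] (spherePiece n i ε ∩ closedBall z r)
      ≤ ENNReal.ofReal (((n : ℝ) ^ 3) ^ (n - 1) * (2 ^ (n - 1) * r ^ (n - 1))) := by
    intro i ε hε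
    have hd : (0 : ℝ) ≤ (n : ℝ) - 1 := by rw [hcast]; positivity
    have h1 := hausdorffMeasure_le_image (L := (n : ℝ≥0) ^ 3) hd (dropCoord n i)
      (spherePiece n i ε ∩ closedBall z r) (by
        intro x hx y hy
        simpa using spherePiece_dist_le n hn i ε hε x hx.1 y hy.1)
    have hcard : Fintype.card {j : Fin n // j ≠ i} = n - 1 := by
      simp [Fintype.card_subtype_compl]
    have h2 : μH[(n : ℝ) - 1] (dropCoord n i '' (spherePiece n i ε ∩ closedBall z r)) ≤
        ENNReal.ofReal ((2 * r) ^ (n - 1)) := by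
      have e : (μH[(n : ℝ) - 1] : Measure ({j : Fin n // j ≠ i} → ℝ)) = volume := by
        rw [hcast, ← hcard]; exact hausdorffMeasure_pi_real
      rw [e]
      calc _ ≤ volume (closedBall (dropCoord n i z) r) := by
            refine measure_mono ?_
            rintro _ ⟨x, hx, rfl⟩
            rw [mem_closedBall, dist_pi_le_iff hr]
            intro j
            have := PiLp.norm_apply_le (x - z) j
            have h3 := mem_closedBall.mp hx.2
            rw [dist_eq_norm] at h3
            rw [Real.dist_eq]
            exact this.trans h3
        _ = _ := by rw [Real.volume_pi_closedBall _ hr, hcard]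
    calc _ ≤ _ := h1
      _ ≤ _ := mul_le_mul_right h2 _
      _ = _ := by
        rw [hcast, ENNReal.rpow_natCast, ENNReal.ofReal_mul (by positivity),
          ENNReal.ofReal_pow (p := (n : ℝ) ^ 3) (by positivity), mul_pow]
        congr 2
        rw [ENNReal.ofReal_pow (by positivity)]
        simp
  rw [sphMeasure, Measure.restrict_apply measurableSet_closedBall]
  calc μH[(n : ℝ) - 1] (closedBall z r ∩ unitSphere n)
      ≤ μH[(n : ℝ) - 1] (⋃ i : Fin n, ((spherePiece n i 1 ∩ closedBall z r) ∪
          (spherePiece n i (-1) ∩ closedBall z r))) := by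
        refine measure_mono fun ω hω => ?_
        obtain ⟨i, hi⟩ := mem_iUnion.mp (unitSphere_subset_pieces n hn hω.2)
        refine mem_iUnion.mpr ⟨i, hi.imp (fun h => ⟨h, hω.1⟩) (fun h => ⟨h, hω.1⟩)⟩
    _ ≤ ∑ i : Fin n, μH[(n : ℝ) - 1] ((spherePiece n i 1 ∩ closedBall z r) ∪
          (spherePiece n i (-1) ∩ closedBall z r)) := measure_iUnion_fintype_le _ _
    _ ≤ ∑ _i : Fin n, (ENNReal.ofReal (((n : ℝ) ^ 3) ^ (n - 1) * (2 ^ (n - 1) * r ^ (n - 1))) +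
          ENNReal.ofReal (((n : ℝ) ^ 3) ^ (n - 1) * (2 ^ (n - 1) * r ^ (n - 1)))) := by
        refine Finset.sum_le_sum fun i _ => (measure_union_le _ _).trans ?_
        exact add_le_add (hpiece i 1 (by simp)) (hpiece i (-1) (by simp))
    _ = _ := by
        rw [← ENNReal.ofReal_add (by positivity) (by positivity)]
        simp only [Finset.sum_const, Finset.card_univ, Fintype.card_fin, nsmul_eq_mul]
        rw [← ENNReal.ofReal_natCast, ← ENNReal.ofReal_mul (by positivity)]
        congr 1
        ring

lemma isFiniteMeasure_sphMeasure (n : ℕ) (hn : 2 ≤ n) : IsFiniteMeasure (sphMeasure n) := by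
  obtain ⟨A, hA, h⟩ := sphMeasure_closedBall_le n hn
  constructor
  have : sphMeasure n univ ≤ sphMeasure n (closedBall 0 1) := by
    rw [sphMeasure, Measure.restrict_apply MeasurableSet.univ,
      Measure.restrict_apply measurableSet_closedBall]
    refine measure_mono fun x hx => ⟨?_, hx.2⟩
    exact sphere_subset_closedBall hx.2
  exact (this.trans (h 0 1 zero_le_one)).trans_lt ENNReal.ofReal_lt_top

/-- The measure on the shell `1/2 < |y| < 1` obtained from surface measure times `dt`. -/
def radialMeasure (n : ℕ) : Measure (Vec n) :=
  Measure.map (fun q : Vec n × ℝ => q.2 • q.1)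
    ((sphMeasure n).prod (volume.restrict (Ioo (1 / 2 : ℝ) 1)))

lemma hausdorffMeasure_eq_smul_volume (n : ℕ) :
    ∃ c : ℝ≥0, (μH[(n : ℝ)] : Measure (Vec n)) = c • volume := by
  have h : (μH[(n : ℝ)] : Measure (Vec n)).IsAddHaarMeasure := by
    have := isAddHaarMeasure_hausdorffMeasure (E := Vec n)
    rwa [finrank_euclideanSpace_fin] at this
  exact ⟨_, Measure.isAddLeftInvariant_eq_smul _ _⟩

lemma ae_mem_unitSphere (n : ℕ) : ∀ᵐ ω ∂(sphMeasure n), ω ∈ unitSphere n :=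
  ae_restrict_mem (isClosed_sphere.measurableSet)

lemma radialMeasure_closedBall_le (n : ℕ) (hn : 2 ≤ n) :
    ∃ A : ℝ, 0 < A ∧ ∀ (z : Vec n) (r : ℝ), 0 ≤ r →
      radialMeasure n (closedBall z r) ≤ ENNReal.ofReal (A * r ^ n) := by
  obtain ⟨A, hA, hball⟩ := sphMeasure_closedBall_le n hn
  have := isFiniteMeasure_sphMeasure n hn
  refine ⟨A * 8 ^ (n - 1) * 4, by positivity, fun z r hr => ?_⟩
  have hmeas : Measurable (fun q : Vec n × ℝ => q.2 • q.1) := by fun_prop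
  rw [radialMeasure, Measure.map_apply hmeas measurableSet_closedBall]
  set m := (sphMeasure n).prod (volume.restrict (Ioo (1 / 2 : ℝ) 1)) with hm
  have hae : ∀ᵐ q ∂m, q ∈ unitSphere n ×ˢ Ioo (1 / 2 : ℝ) 1 := by
    have h1 : ∀ᵐ q ∂m, q.1 ∈ unitSphere n :=
      Measure.quasiMeasurePreserving_fst.ae (ae_mem_unitSphere n)
    have h2 : ∀ᵐ q ∂m, q.2 ∈ Ioo (1 / 2 : ℝ) 1 :=
      Measure.quasiMeasurePreserving_snd.ae (ae_restrict_mem measurableSet_Ioo)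
    filter_upwards [h1, h2] with q a b using ⟨a, b⟩
  rw [← Measure.measure_inter_eq_of_ae hae]
  rcases ((unitSphere n ×ˢ Ioo (1 / 2 : ℝ) 1) ∩
    (fun q : Vec n × ℝ => q.2 • q.1) ⁻¹' closedBall z r).eq_empty_or_nonempty with h | h
  · rw [h]; simp
  obtain ⟨⟨ω₀, t₀⟩, ⟨hω₀, ht₀⟩, hz₀⟩ := h
  have hω₀n : ‖ω₀‖ = 1 := by simpa [unitSphere] using hω₀
  have hsub : ((unitSphere n ×ˢ Ioo (1 / 2 : ℝ) 1) ∩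
      (fun q : Vec n × ℝ => q.2 • q.1) ⁻¹' closedBall z r) ⊆
      closedBall ω₀ (8 * r) ×ˢ Icc (t₀ - 2 * r) (t₀ + 2 * r) := by
    rintro ⟨ω, t⟩ ⟨⟨hω, ht⟩, hz⟩
    have hωn : ‖ω‖ = 1 := by simpa [unitSphere] using hω
    simp only [mem_preimage, mem_closedBall] at hz hz₀
    simp only at ht ht₀
    have hd : ‖t • ω - t₀ • ω₀‖ ≤ 2 * r := by
      rw [← dist_eq_norm]
      linarith [dist_triangle_right (t • ω) (t₀ • ω₀) z]
    have ht' : |t - t₀| ≤ 2 * r := by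
      have := abs_norm_sub_norm_le (t • ω) (t₀ • ω₀)
      rw [norm_smul, norm_smul, hωn, hω₀n, Real.norm_of_nonneg (by linarith [ht.1]),
        Real.norm_of_nonneg (by linarith [ht₀.1]), mul_one, mul_one] at this
      linarith
    refine ⟨?_, ?_⟩
    · rw [mem_closedBall, dist_eq_norm]
      have h1 : ‖t₀ • (ω - ω₀)‖ ≤ 4 * r := by
        have e : t₀ • (ω - ω₀) = (t • ω - t₀ • ω₀) - (t - t₀) • ω := by module
        rw [e]
        refine (norm_sub_le _ _).trans ?_
        rw [norm_smul (t - t₀), hωn, Real.norm_eq_abs]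
        linarith
      rw [norm_smul, Real.norm_of_nonneg (by linarith [ht₀.1])] at h1
      nlinarith [ht₀.1, norm_nonneg (ω - ω₀)]
    · rw [abs_le] at ht'
      constructor <;> dsimp only <;> linarith
  calc _ ≤ m (closedBall ω₀ (8 * r) ×ˢ Icc (t₀ - 2 * r) (t₀ + 2 * r)) := measure_mono hsub
    _ = sphMeasure n (closedBall ω₀ (8 * r)) *
        (volume.restrict (Ioo (1 / 2 : ℝ) 1)) (Icc (t₀ - 2 * r) (t₀ + 2 * r)) := by
        rw [hm, Measure.prod_prod]
    _ ≤ ENNReal.ofReal (A * (8 * r) ^ (n - 1)) * ENNReal.ofReal (4 * r) := by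
        refine mul_le_mul' (hball _ _ (by positivity)) ?_
        refine (Measure.restrict_apply_le _ _).trans ?_
        rw [Real.volume_Icc]
        exact ENNReal.ofReal_le_ofReal (by linarith)
    _ = _ := by
        rw [← ENNReal.ofReal_mul (by positivity)]
        congr 1
        obtain ⟨k, rfl⟩ : ∃ k, n = k + 1 := ⟨n - 1, by lia⟩
        simp only [Nat.add_sub_cancel]
        ring

/-- The polar-coordinates inequality on the shell `1/2 < |y| < 1`. -/
lemma radialMeasure_le_volume (n : ℕ) (hn : 2 ≤ n) :
    ∃ c : ℝ≥0, radialMeasure n ≤ c • (volume : Measure (Vec n)) := by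
  obtain ⟨A, hA, hball⟩ := radialMeasure_closedBall_le n hn
  obtain ⟨c, hc⟩ := hausdorffMeasure_eq_smul_volume n
  have hA0 : ENNReal.ofReal A ≠ 0 := by simpa using hA
  have h : (ENNReal.ofReal A)⁻¹ • radialMeasure n ≤ μH[(n : ℝ)] := by
    refine Measure.le_hausdorffMeasure _ _ 1 one_pos fun s hs => ?_
    rcases s.eq_empty_or_nonempty with rfl | ⟨y, hy⟩
    · simp
    have hfin : ediam s ≠ ⊤ := ne_top_of_le_ne_top ENNReal.one_ne_top hs
    have hsub : s ⊆ closedBall y (diam s) := fun x hx =>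
      mem_closedBall.mpr (dist_le_diam_of_mem' hfin hx hy)
    calc (ENNReal.ofReal A)⁻¹ * radialMeasure n s
        ≤ (ENNReal.ofReal A)⁻¹ * ENNReal.ofReal (A * diam s ^ n) :=
          mul_le_mul_right ((measure_mono hsub).trans (hball _ _ diam_nonneg)) _
      _ = ENNReal.ofReal (diam s) ^ n := by
          rw [ENNReal.ofReal_mul hA.le, ← mul_assoc,
            ENNReal.inv_mul_cancel hA0 ENNReal.ofReal_ne_top, one_mul,
            ENNReal.ofReal_pow diam_nonneg]
      _ = ediam s ^ (n : ℝ) := by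
          rw [diam, ENNReal.ofReal_toReal hfin, ENNReal.rpow_natCast]
  refine ⟨A.toNNReal * c, ?_⟩
  rw [hc] at h
  intro s
  have := h s
  simp only [Measure.smul_apply, smul_eq_mul] at this ⊢
  rw [ENNReal.inv_mul_le_iff hA0 ENNReal.ofReal_ne_top] at this
  refine this.trans (le_of_eq ?_)
  simp only [ENNReal.smul_def, smul_eq_mul, ENNReal.coe_mul, mul_assoc]
  rfl

lemma exists_injOn_radius {n : ℕ} (f : Vec n → Vec n) (A : Vec n →L[ℝ] Vec n) :
    ∃ δ : ℝ≥0, δ ≠ 0 ∧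
      (A.det ≠ 0 → ∀ s : Set (Vec n), ApproximatesLinearOn f A s δ → InjOn f s) := by
  by_cases hA : A.det = 0
  · exact ⟨1, one_ne_zero, fun h => absurd hA h⟩
  set e := A.toContinuousLinearEquivOfDetNeZero hA with he
  have hcoe : (e : Vec n →L[ℝ] Vec n) = A :=
    ContinuousLinearMap.coe_toContinuousLinearEquivOfDetNeZero A hA
  rcases e.subsingleton_or_nnnorm_symm_pos with hs | hpos
  · refine ⟨1, one_ne_zero, fun _ s hf => ?_⟩
    rw [← hcoe] at hf
    exact hf.injOn (Or.inl hs)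
  · refine ⟨‖(e.symm : Vec n →L[ℝ] Vec n)‖₊⁻¹ / 2, ?_, fun _ s hf => ?_⟩
    · exact (half_pos (inv_pos.mpr hpos)).ne'
    · rw [← hcoe] at hf
      exact hf.injOn (Or.inr (half_lt_self (inv_pos.mpr hpos)))

/-- Change of variables for a differentiable map of bounded multiplicity. -/
lemma lintegral_abs_det_mul_comp_le {n : ℕ} (f : Vec n → Vec n) (s T : Set (Vec n))
    (hs : MeasurableSet s) (hf : ∀ x ∈ s, DifferentiableAt ℝ f x) (hT : MeasurableSet T)
    (hsT : MapsTo f s T) (N : ℝ≥0∞)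
    (hN : ∀ y, (({z ∈ s | f z = y}).encard : ℝ≥0∞) ≤ N)
    (φ : Vec n → ℝ≥0∞) (hφ : Measurable φ) :
    ∫⁻ x in s, ENNReal.ofReal |(fderiv ℝ f x).det| * φ (f x) ≤ N * ∫⁻ y in T, φ y := by
  have hdet : Measurable fun x => (fderiv ℝ f x).det :=
    ContinuousLinearMap.continuous_det.measurable.comp (measurable_fderiv ℝ f)
  set s' := s ∩ {x | (fderiv ℝ f x).det ≠ 0} with hs'
  have hs'm : MeasurableSet s' := hs.inter (hdet (measurableSet_singleton 0).compl)
  have hd : ∀ x ∈ s', HasFDerivWithinAt f (fderiv ℝ f x) s' x :=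
    fun x hx => (hf x hx.1).hasFDerivAt.hasFDerivWithinAt
  choose r hr0 hr using exists_injOn_radius f
  obtain ⟨t, A, hdisj, htm, hcov, happ, hA⟩ :=
    exists_partition_approximatesLinearOn_of_hasFDerivWithinAt f s' (fderiv ℝ f) hd r hr0
  have hinj : ∀ k, InjOn f (s' ∩ t k) := by
    intro k
    rcases s'.eq_empty_or_nonempty with h | h
    · rw [h]; simp
    · obtain ⟨y, hy, hAy⟩ := hA h k
      exact hr _ (by rw [hAy]; exact hy.2) _ (happ k)
  have hd' : ∀ k, ∀ x ∈ s' ∩ t k, HasFDerivWithinAt f (fderiv ℝ f x) (s' ∩ t k) x :=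
    fun k x hx => (hd x hx.1).mono inter_subset_left
  have him : ∀ k, MeasurableSet (f '' (s' ∩ t k)) := fun k =>
    measurable_image_of_fderivWithin (hs'm.inter (htm k)) (hd' k) (hinj k)
  calc ∫⁻ x in s, ENNReal.ofReal |(fderiv ℝ f x).det| * φ (f x)
      = ∫⁻ x in s', ENNReal.ofReal |(fderiv ℝ f x).det| * φ (f x) := by
        rw [← lintegral_indicator hs, ← lintegral_indicator hs'm]
        congr 1
        ext x
        by_cases h0 : (fderiv ℝ f x).det = 0
        · simp [indicator, h0]
        · simp [indicator, hs', h0]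
    _ ≤ ∫⁻ x in ⋃ k, (s' ∩ t k), ENNReal.ofReal |(fderiv ℝ f x).det| * φ (f x) := by
        refine lintegral_mono_set ?_
        rw [← inter_iUnion]
        exact fun x hx => ⟨hx, hcov hx⟩
    _ ≤ ∑' k, ∫⁻ x in s' ∩ t k, ENNReal.ofReal |(fderiv ℝ f x).det| * φ (f x) :=
        lintegral_iUnion_le _ _
    _ = ∑' k, ∫⁻ y in f '' (s' ∩ t k), φ y := by
        congr 1
        ext k
        exact (lintegral_image_eq_lintegral_abs_det_fderiv_mul volume (hs'm.inter (htm k))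
          (hd' k) (hinj k) φ).symm
    _ = ∫⁻ y, ∑' k, (f '' (s' ∩ t k)).indicator φ y := by
        rw [lintegral_tsum fun k => (hφ.indicator (him k)).aemeasurable]
        congr 1
        ext k
        rw [lintegral_indicator (him k)]
    _ ≤ ∫⁻ y, N * T.indicator φ y := by
        refine lintegral_mono fun y => ?_
        by_cases hyT : y ∈ T
        · have e : ∀ k, (f '' (s' ∩ t k)).indicator φ y =
              ({k | y ∈ f '' (s' ∩ t k)} : Set ℕ).indicator (fun _ => (1 : ℝ≥0∞)) k * φ y := by
            intro k
            by_cases h : y ∈ f '' (s' ∩ t k)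
            · rw [indicator_of_mem h, indicator_of_mem (by exact h), one_mul]
            · rw [indicator_of_notMem h, indicator_of_notMem (by exact h), zero_mul]
          simp_rw [e]
          rw [ENNReal.tsum_mul_right, ← tsum_subtype, ENNReal.tsum_set_one,
            indicator_of_mem hyT]
          refine mul_le_mul_left ((?_ : _ ≤ _).trans (hN y)) _
          have hz : ∀ k : ℕ, ∃ z, y ∈ f '' (s' ∩ t k) → z ∈ s' ∩ t k ∧ f z = y := by
            intro k
            by_cases h : y ∈ f '' (s' ∩ t k)
            · obtain ⟨z, hz⟩ := h
              exact ⟨z, fun _ => hz⟩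
            · exact ⟨0, fun h' => absurd h' h⟩
          choose z hz using hz
          have : ({k | y ∈ f '' (s' ∩ t k)} : Set ℕ).encard ≤ ({z ∈ s | f z = y}).encard := by
            refine encard_le_encard_of_injOn (f := z) ?_ ?_
            · intro k hk
              exact ⟨(hz k hk).1.1.1, (hz k hk).2⟩
            · intro k hk l hl hkl
              by_contra hne
              refine disjoint_left.mp (hdisj hne) (hz k hk).1.2 ?_
              rw [hkl]
              exact (hz l hl).1.2
          exact_mod_cast this
        · have e : ∀ k, (f '' (s' ∩ t k)).indicator φ y = 0 := by
            intro k
            refine indicator_of_notMem (fun h => hyT ?_) _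
            obtain ⟨z, hz, rfl⟩ := h
            exact hsT hz.1.1
          simp [e]
    _ = N * ∫⁻ y in T, φ y := by
        rw [lintegral_const_mul _ (hφ.indicator hT), lintegral_indicator hT]

lemma lintegral_annulus_le (n : ℕ) (hn : 2 ≤ n) :
    ∃ W : ℝ, 0 < W ∧ ∀ m M : ℝ, 0 < m → m ≤ M →
      ∫⁻ y in {y : Vec n | ‖y‖ ∈ Icc m M}, ENNReal.ofReal ((‖y‖ ^ n)⁻¹) ≤
        ENNReal.ofReal (W * Real.log (M / m)) := by
  have : Nontrivial (Vec n) := by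
    have : Nonempty (Fin n) := ⟨⟨0, by lia⟩⟩
    infer_instance
  have hb : 0 < (volume : Measure (Vec n)).real (ball 0 1) :=
    ENNReal.toReal_pos (measure_ball_pos _ _ one_pos).ne' measure_ball_lt_top.ne
  refine ⟨n * (volume : Measure (Vec n)).real (ball 0 1), by positivity, fun m M hm hmM => ?_⟩
  set F : ℝ → ℝ := (Icc m M).indicator fun t => (t ^ n)⁻¹ with hF
  have hmeas : MeasurableSet {y : Vec n | ‖y‖ ∈ Icc m M} := measurable_norm measurableSet_Icc
  have hfr : Module.finrank ℝ (Vec n) = n := finrank_euclideanSpace_fin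
  have hpoint : ∀ t : ℝ, t ^ (n - 1) • F t = (Icc m M).indicator (fun t => t⁻¹) t := by
    intro t
    by_cases ht : t ∈ Icc m M
    · have ht0 : t ≠ 0 := (hm.trans_le ht.1).ne'
      rw [hF, indicator_of_mem ht, indicator_of_mem ht]
      obtain ⟨k, rfl⟩ : ∃ k, n = k + 1 := ⟨n - 1, by lia⟩
      simp only [Nat.add_sub_cancel, smul_eq_mul]
      field_simp
      ring
    · rw [hF, indicator_of_notMem ht, indicator_of_notMem ht, smul_zero]
  have hci : IntegrableOn (fun t : ℝ => t⁻¹) (Icc m M) :=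
    ContinuousOn.integrableOn_Icc
      (continuousOn_id.inv₀ fun t ht => (hm.trans_le ht.1).ne')
  have hint : Integrable (fun y : Vec n => F ‖y‖) := by
    rw [integrable_fun_norm_addHaar, hfr]
    simp_rw [hpoint]
    exact ((integrable_indicator_iff measurableSet_Icc).mpr hci).integrableOn
  have hF0 : ∀ t, 0 ≤ F t := by
    intro t
    refine indicator_nonneg (fun t ht => ?_) t
    have := hm.trans_le ht.1
    positivity
  calc ∫⁻ y in {y : Vec n | ‖y‖ ∈ Icc m M}, ENNReal.ofReal ((‖y‖ ^ n)⁻¹)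
      = ∫⁻ y : Vec n, ENNReal.ofReal (F ‖y‖) := by
        rw [← lintegral_indicator hmeas]
        congr 1
        ext y
        by_cases hy : ‖y‖ ∈ Icc m M
        · rw [hF, indicator_of_mem (by exact hy), indicator_of_mem hy]
        · rw [hF, indicator_of_notMem (by exact hy), indicator_of_notMem hy, ENNReal.ofReal_zero]
    _ = ENNReal.ofReal (∫ y : Vec n, F ‖y‖) :=
        (ofReal_integral_eq_lintegral_ofReal hint (ae_of_all _ fun y => hF0 _)).symm
    _ ≤ _ := by
        refine ENNReal.ofReal_le_ofReal (le_of_eq ?_)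
        have hpos : Icc m M ⊆ Ioi 0 := fun t ht => mem_Ioi.mpr (hm.trans_le ht.1)
        rw [integral_fun_norm_addHaar, hfr]
        simp_rw [hpoint]
        rw [setIntegral_indicator measurableSet_Icc,
          inter_eq_right.mpr hpos, integral_Icc_eq_integral_Ioc,
          ← intervalIntegral.integral_of_le hmM, integral_inv_of_pos hm (hm.trans_le hmM)]
        simp only [smul_eq_mul, nsmul_eq_mul]
        ring

/-- A quasiregular map of the ball, without zeros, satisfying the growth bounds relative to its
value at the centre and the multiplicity bound on concentric balls. -/
structure IsCentered (n : ℕ) (K C₀ α a C₁ : ℝ) (F : Vec n → Vec n) : Prop where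
  measurable : Measurable F
  differentiableAt : ∀ x ∈ unitBall n, DifferentiableAt ℝ F x
  ne_zero : ∀ x ∈ unitBall n, F x ≠ 0
  dilatation : ∀ᵐ x ∂(volume.restrict (unitBall n)),
    ‖fderiv ℝ F x‖ ^ n ≤ K * |(fderiv ℝ F x).det|
  lower : ∀ y ∈ unitBall n, C₀⁻¹ * ((1 - ‖y‖) / (1 + ‖y‖)) ^ α ≤ ‖F y‖ / ‖F 0‖
  upper : ∀ y ∈ unitBall n, ‖F y‖ / ‖F 0‖ ≤ C₀ * ((1 + ‖y‖) / (1 - ‖y‖)) ^ α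
  multiplicity : ∀ r : ℝ, 0 < r → r < 1 → ∀ y : Vec n,
    (({z ∈ Metric.ball (0 : Vec n) r | F z = y}).encard : ℝ≥0∞) ≤
      ENNReal.ofReal (C₁ / (1 - r) ^ a)

/-- The length of the logarithmic gradient. -/
def logGrad {n : ℕ} (F : Vec n → Vec n) (y : Vec n) : ℝ := ‖fderiv ℝ F y‖ / ‖F y‖

lemma measurable_logGrad {n : ℕ} {F : Vec n → Vec n} (hF : Measurable F) :
    Measurable (logGrad F) :=
  (measurable_fderiv ℝ F).norm.div hF.norm

lemma logGrad_nonneg {n : ℕ} (F : Vec n → Vec n) (y : Vec n) : 0 ≤ logGrad F y := by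
  unfold logGrad; positivity

lemma log_growth_le {C₀ α ε : ℝ} (hC₀ : 1 ≤ C₀) (hα : 0 < α) (hε : 0 < ε) {r : ℝ} (hr0 : 0 < r)
    (hr1 : r < 1) :
    Real.log ((C₀ * ((1 + r) / (1 - r)) ^ α) / (C₀⁻¹ * ((1 - r) / (1 + r)) ^ α)) ≤
      (2 * Real.log C₀ + 2 * α * (2 ^ ε / ε)) * (1 - r) ^ (-ε) := by
  have h1 : 0 < 1 - r := by linarith
  have h2 : 0 < 1 + r := by linarith
  have hq : 0 < (1 + r) / (1 - r) := by positivity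
  have hC : 0 < C₀ := by linarith
  have hlog : Real.log ((C₀ * ((1 + r) / (1 - r)) ^ α) / (C₀⁻¹ * ((1 - r) / (1 + r)) ^ α)) =
      2 * Real.log C₀ + 2 * α * Real.log ((1 + r) / (1 - r)) := by
    rw [Real.log_div (by positivity) (by positivity), Real.log_mul (by positivity) (by positivity),
      Real.log_mul (by positivity) (by positivity), Real.log_rpow hq, Real.log_rpow (by positivity),
      Real.log_inv, ← inv_div (1 + r), Real.log_inv]
    ring
  have hle : Real.log ((1 + r) / (1 - r)) ≤ 2 ^ ε / ε * (1 - r) ^ (-ε) := by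
    calc Real.log ((1 + r) / (1 - r)) ≤ Real.log (2 / (1 - r)) :=
          Real.log_le_log hq (by gcongr; linarith)
      _ ≤ (2 / (1 - r)) ^ ε / ε := Real.log_le_rpow_div (by positivity) hε
      _ = _ := by
        rw [Real.div_rpow (by norm_num) h1.le, Real.rpow_neg h1.le]
        field_simp
  have hone : 1 ≤ (1 - r) ^ (-ε) :=
    Real.one_le_rpow_of_pos_of_le_one_of_nonpos h1 (by linarith) (by linarith)
  have hlogC : 0 ≤ Real.log C₀ := Real.log_nonneg hC₀
  rw [hlog]
  nlinarith [mul_le_mul_of_nonneg_left hone hlogC, mul_le_mul_of_nonneg_left hle hα.le]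

/-- The growth of the logarithmic energy on concentric balls. -/
lemma energy_le (n : ℕ) (hn : 2 ≤ n) (K C₀ α a C₁ b : ℝ) (hK : 1 ≤ K) (hC₀ : 1 ≤ C₀) (hα : 0 < α)
    (hC₁ : 0 < C₁) (hb : a < b) :
    ∃ E : ℝ, 0 < E ∧ ∀ F, IsCentered n K C₀ α a C₁ F → ∀ r : ℝ, 0 < r → r < 1 →
      ∫⁻ y in ball (0 : Vec n) r, ENNReal.ofReal (logGrad F y ^ n) ≤
        ENNReal.ofReal (E * (1 - r) ^ (-b)) := by
  obtain ⟨W, hW, hann⟩ := lintegral_annulus_le n hn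
  have hε : 0 < b - a := by linarith
  have hlogC : 0 ≤ Real.log C₀ := Real.log_nonneg hC₀
  set H := 2 * Real.log C₀ + 2 * α * (2 ^ (b - a) / (b - a)) with hH
  have hH0 : 0 < H := by positivity
  refine ⟨K * (C₁ * (W * H)), by positivity, fun F hF r hr0 hr1 => ?_⟩
  have h1 : 0 < 1 - r := by linarith
  have h0mem : (0 : Vec n) ∈ unitBall n := by simp [unitBall]
  have hF0 : 0 < ‖F 0‖ := norm_pos_iff.mpr (hF.ne_zero 0 h0mem)
  have hsub : ball (0 : Vec n) r ⊆ unitBall n := ball_subset_ball hr1.le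
  set m := C₀⁻¹ * ((1 - r) / (1 + r)) ^ α * ‖F 0‖ with hm
  set M := C₀ * ((1 + r) / (1 - r)) ^ α * ‖F 0‖ with hM
  have hm0 : 0 < m := by positivity
  have hmaps : MapsTo F (ball (0 : Vec n) r) {y | ‖y‖ ∈ Icc m M} := by
    intro y hy
    have hyr : ‖y‖ < r := by simpa using hy
    have hy0 := norm_nonneg y
    constructor
    · refine le_trans ?_ ((le_div_iff₀ hF0).mp (hF.lower y (hsub hy)))
      have hy1 : 0 < 1 - ‖y‖ := by linarith
      rw [hm]
      gcongr
    · refine le_trans ((div_le_iff₀ hF0).mp (hF.upper y (hsub hy))) ?_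
      have hy1 : 0 < 1 - ‖y‖ := by linarith
      rw [hM]
      gcongr
  have hmM : m ≤ M := by
    have := hmaps (mem_ball_self hr0)
    exact this.1.trans this.2
  have hlog : Real.log (M / m) ≤ H * (1 - r) ^ (-(b - a)) := by
    rw [hM, hm, mul_div_mul_right _ _ hF0.ne']
    exact log_growth_le hC₀ hα hε hr0 hr1
  have hae : ∀ᵐ y ∂(volume.restrict (ball (0 : Vec n) r)),
      ENNReal.ofReal (logGrad F y ^ n) ≤ ENNReal.ofReal K *
        (ENNReal.ofReal |(fderiv ℝ F y).det| * ENNReal.ofReal ((‖F y‖ ^ n)⁻¹)) := by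
    filter_upwards [ae_restrict_of_ae_restrict_of_subset hsub hF.dilatation] with y hy
    rw [← ENNReal.ofReal_mul (abs_nonneg _), ← ENNReal.ofReal_mul (by linarith)]
    refine ENNReal.ofReal_le_ofReal ?_
    rw [logGrad, div_pow, div_eq_mul_inv, ← mul_assoc]
    exact mul_le_mul_of_nonneg_right hy (by positivity)
  calc ∫⁻ y in ball (0 : Vec n) r, ENNReal.ofReal (logGrad F y ^ n)
      ≤ ∫⁻ y in ball (0 : Vec n) r, ENNReal.ofReal K *
        (ENNReal.ofReal |(fderiv ℝ F y).det| * ENNReal.ofReal ((‖F y‖ ^ n)⁻¹)) :=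
        lintegral_mono_ae hae
    _ = ENNReal.ofReal K * ∫⁻ y in ball (0 : Vec n) r,
        (ENNReal.ofReal |(fderiv ℝ F y).det| * ENNReal.ofReal ((‖F y‖ ^ n)⁻¹)) :=
        lintegral_const_mul' _ _ ENNReal.ofReal_ne_top
    _ ≤ ENNReal.ofReal K * (ENNReal.ofReal (C₁ / (1 - r) ^ a) *
        ∫⁻ y in {y : Vec n | ‖y‖ ∈ Icc m M}, ENNReal.ofReal ((‖y‖ ^ n)⁻¹)) := by
        refine mul_le_mul_right ?_ _
        exact lintegral_abs_det_mul_comp_le F _ _ measurableSet_ball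
          (fun x hx => hF.differentiableAt x (hsub hx)) (measurable_norm measurableSet_Icc) hmaps _
          (hF.multiplicity r hr0 hr1) (fun y => ENNReal.ofReal ((‖y‖ ^ n)⁻¹)) (by fun_prop)
    _ ≤ ENNReal.ofReal K * (ENNReal.ofReal (C₁ / (1 - r) ^ a) *
        ENNReal.ofReal (W * (H * (1 - r) ^ (-(b - a))))) := by
        refine mul_le_mul_right (mul_le_mul_right ((hann m M hm0 hmM).trans ?_) _) _
        exact ENNReal.ofReal_le_ofReal (mul_le_mul_of_nonneg_left hlog hW.le)
    _ = _ := by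
        rw [← ENNReal.ofReal_mul (by positivity), ← ENNReal.ofReal_mul (by linarith)]
        congr 1
        have e : (1 - r) ^ (-b) = (1 - r) ^ (-(b - a)) * ((1 - r) ^ a)⁻¹ := by
          rw [← Real.rpow_neg h1.le, ← Real.rpow_add h1]
          congr 1
          ring
        rw [e, div_eq_mul_inv]
        ring

/-- The dyadic spherical shells accumulating at the unit sphere. -/
def dyadicShell (n k : ℕ) : Set (Vec n) := {y | ‖y‖ ∈ Ico (1 - (1 / 2 : ℝ) ^ k) (1 - (1 / 2) ^ (k + 1))}

lemma measurableSet_dyadicShell (n k : ℕ) : MeasurableSet (dyadicShell n k) :=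
  measurable_norm measurableSet_Ico

lemma unitBall_subset_iUnion_dyadicShell (n : ℕ) : unitBall n ⊆ ⋃ k, dyadicShell n k := by
  intro y hy
  have hy1 : ‖y‖ < 1 := by simpa [unitBall] using hy
  have hex : ∃ k : ℕ, (1 / 2 : ℝ) ^ k < 1 - ‖y‖ :=
    exists_pow_lt_of_lt_one (by linarith) (by norm_num)
  have hspec := Nat.find_spec hex
  have hpos : Nat.find hex ≠ 0 := by
    intro h
    rw [h, pow_zero] at hspec
    linarith [norm_nonneg y]
  obtain ⟨k, hk⟩ := Nat.exists_eq_succ_of_ne_zero hpos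
  have hmin := Nat.find_min hex (m := k) (by lia)
  rw [hk] at hspec
  exact mem_iUnion.mpr ⟨k, by linarith, by simp only [Nat.succ_eq_add_one] at hspec; linarith⟩

lemma radialMeasure_dyadicShell_le (n : ℕ) (k : ℕ) [IsFiniteMeasure (sphMeasure n)] :
    radialMeasure n (dyadicShell n k) ≤
      sphMeasure n univ * ENNReal.ofReal ((1 / 2) ^ (k + 1)) := by
  have hmeas : Measurable (fun q : Vec n × ℝ => q.2 • q.1) := by fun_prop
  rw [radialMeasure, Measure.map_apply hmeas (measurableSet_dyadicShell n k)]
  set m := (sphMeasure n).prod (volume.restrict (Ioo (1 / 2 : ℝ) 1)) with hm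
  have h1 : ∀ᵐ q ∂m, q.1 ∈ unitSphere n :=
    Measure.quasiMeasurePreserving_fst.ae (ae_mem_unitSphere n)
  have h2 : ∀ᵐ q ∂m, q.2 ∈ Ioo (1 / 2 : ℝ) 1 :=
    Measure.quasiMeasurePreserving_snd.ae (ae_restrict_mem measurableSet_Ioo)
  calc _ ≤ m (univ ×ˢ Ico (1 - (1 / 2 : ℝ) ^ k) (1 - (1 / 2) ^ (k + 1))) := by
        refine measure_mono_ae ?_
        filter_upwards [h1, h2] with q a b hq
        have hn : ‖q.1‖ = 1 := by simpa [unitSphere] using a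
        have hq' : ‖q.2 • q.1‖ ∈ Ico (1 - (1 / 2 : ℝ) ^ k) (1 - (1 / 2) ^ (k + 1)) := hq
        rw [norm_smul, hn, mul_one, Real.norm_of_nonneg (by linarith [b.1])] at hq'
        exact ⟨mem_univ _, hq'⟩
    _ ≤ sphMeasure n univ * volume (Ico (1 - (1 / 2 : ℝ) ^ k) (1 - (1 / 2) ^ (k + 1))) := by
        rw [hm, Measure.prod_prod]
        exact mul_le_mul_right (Measure.restrict_apply_le _ _) _
    _ = _ := by
        rw [Real.volume_Ico]
        congr 2
        ring

lemma le_add_zpow_mul_pow {n : ℕ} (hn : 2 ≤ n) {u t : ℝ} (hu : 0 ≤ u) (ht : 0 < t) :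
    u ≤ t + (t ^ (n - 1))⁻¹ * u ^ n := by
  rcases le_total u t with h | h
  · have : 0 ≤ (t ^ (n - 1))⁻¹ * u ^ n := by positivity
    linarith
  · obtain ⟨k, rfl⟩ : ∃ k, n = k + 1 := ⟨n - 1, by lia⟩
    simp only [Nat.add_sub_cancel]
    have h1 : t ^ k ≤ u ^ k := pow_le_pow_left₀ ht.le h k
    have h2 : u ≤ (t ^ k)⁻¹ * u ^ (k + 1) := by
      rw [inv_mul_eq_div, le_div_iff₀ (by positivity), pow_succ, mul_comm]
      exact mul_le_mul_of_nonneg_right h1 hu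
    linarith

/-- The logarithm of a centered quasiregular map has uniformly bounded mean radial variation. -/
lemma exists_radial_variation_bound (n : ℕ) (hn : 2 ≤ n) (K C₀ α a C₁ : ℝ) (hK : 1 ≤ K)
    (hC₀ : 1 ≤ C₀) (hα : 0 < α) (ha0 : 0 ≤ a) (ha : a < (n : ℝ) - 1) (hC₁ : 0 < C₁) :
    ∃ C : ℝ≥0∞, C ≠ ⊤ ∧ ∀ F, IsCentered n K C₀ α a C₁ F →
      ∫⁻ ω, (∫⁻ t in Ioo (1 / 2 : ℝ) 1, ENNReal.ofReal (logGrad F (t • ω))) ∂(sphMeasure n) ≤ C := by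
  have hfin := isFiniteMeasure_sphMeasure n hn
  have hn1 : (0 : ℝ) < (n : ℝ) - 1 := by linarith
  obtain ⟨b, hab, hbn⟩ := exists_between ha
  obtain ⟨θ, hθ0, hθ1⟩ := exists_between ((div_lt_one hn1).mpr hbn)
  rw [div_lt_iff₀ hn1] at hθ0
  obtain ⟨E, hE, hen⟩ := energy_le n hn K C₀ α a C₁ b hK hC₀ hα hC₁ hab
  obtain ⟨c, hc⟩ := radialMeasure_le_volume n hn
  set q₁ : ℝ := 2 ^ (θ - 1) with hq₁
  set q₂ : ℝ := 2 ^ (b - θ * ((n : ℝ) - 1)) with hq₂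
  have hq₁1 : q₁ < 1 := Real.rpow_lt_one_of_one_lt_of_neg (by norm_num) (by linarith)
  have hq₂1 : q₂ < 1 := Real.rpow_lt_one_of_one_lt_of_neg (by norm_num) (by linarith)
  have hq₁0 : 0 < q₁ := by positivity
  have hq₂0 : 0 < q₂ := by positivity
  refine ⟨∑' k : ℕ, (sphMeasure n univ * ENNReal.ofReal q₁ ^ k +
    c * ENNReal.ofReal (E * 2 ^ b) * ENNReal.ofReal q₂ ^ k), ?_, fun F hF => ?_⟩
  · rw [ENNReal.tsum_add, ENNReal.tsum_mul_left, ENNReal.tsum_mul_left, ENNReal.tsum_geometric,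
      ENNReal.tsum_geometric]
    refine ENNReal.add_ne_top.mpr ⟨ENNReal.mul_ne_top (measure_ne_top _ _) ?_,
      ENNReal.mul_ne_top (ENNReal.mul_ne_top ENNReal.coe_ne_top ENNReal.ofReal_ne_top) ?_⟩
    · rw [ENNReal.inv_ne_top]
      exact (tsub_pos_of_lt (ENNReal.ofReal_lt_one.mpr hq₁1)).ne'
    · rw [ENNReal.inv_ne_top]
      exact (tsub_pos_of_lt (ENNReal.ofReal_lt_one.mpr hq₂1)).ne'
  have hmG := measurable_logGrad hF.measurable
  have hmeas : Measurable (fun q : Vec n × ℝ => q.2 • q.1) := by fun_prop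
  have hball : ∀ᵐ y ∂(radialMeasure n), y ∈ unitBall n := by
    rw [radialMeasure]
    refine (ae_map_iff (p := fun y => y ∈ unitBall n) hmeas.aemeasurable measurableSet_ball).mpr ?_
    have h1 : ∀ᵐ q ∂((sphMeasure n).prod (volume.restrict (Ioo (1 / 2 : ℝ) 1))),
        q.1 ∈ unitSphere n := Measure.quasiMeasurePreserving_fst.ae (ae_mem_unitSphere n)
    have h2 : ∀ᵐ q ∂((sphMeasure n).prod (volume.restrict (Ioo (1 / 2 : ℝ) 1))),
        q.2 ∈ Ioo (1 / 2 : ℝ) 1 :=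
      Measure.quasiMeasurePreserving_snd.ae (ae_restrict_mem measurableSet_Ioo)
    filter_upwards [h1, h2] with q a b
    have hn : ‖q.1‖ = 1 := by simpa [unitSphere] using a
    rw [unitBall, mem_ball_zero_iff, norm_smul, hn, mul_one,
      Real.norm_of_nonneg (by linarith [b.1])]
    exact b.2
  calc ∫⁻ ω, (∫⁻ t in Ioo (1 / 2 : ℝ) 1, ENNReal.ofReal (logGrad F (t • ω))) ∂(sphMeasure n)
      = ∫⁻ y, ENNReal.ofReal (logGrad F y) ∂(radialMeasure n) := by
        rw [radialMeasure, lintegral_map hmG.ennreal_ofReal hmeas]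
        exact (lintegral_prod _ (hmG.ennreal_ofReal.comp hmeas).aemeasurable).symm
    _ ≤ ∫⁻ y in ⋃ k, dyadicShell n k, ENNReal.ofReal (logGrad F y) ∂(radialMeasure n) := by
        rw [← setLIntegral_univ]
        refine lintegral_mono_set' ?_
        filter_upwards [hball] with y hy _ using unitBall_subset_iUnion_dyadicShell n hy
    _ ≤ ∑' k, ∫⁻ y in dyadicShell n k, ENNReal.ofReal (logGrad F y) ∂(radialMeasure n) :=
        lintegral_iUnion_le _ _
    _ ≤ _ := by
        refine ENNReal.tsum_le_tsum fun k => ?_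
        set t : ℝ := 2 ^ (θ * k) with ht
        have ht0 : 0 < t := by positivity
        have hhalf : (0 : ℝ) < (1 / 2) ^ (k + 1) := by positivity
        have hhalf1 : ((1 : ℝ) / 2) ^ (k + 1) < 1 :=
          pow_lt_one₀ (by norm_num) (by norm_num) (by simp)
        calc ∫⁻ y in dyadicShell n k, ENNReal.ofReal (logGrad F y) ∂(radialMeasure n)
            ≤ ∫⁻ y in dyadicShell n k, (ENNReal.ofReal t + ENNReal.ofReal ((t ^ (n - 1))⁻¹) *
                ENNReal.ofReal (logGrad F y ^ n)) ∂(radialMeasure n) := by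
              refine lintegral_mono fun y => ?_
              rw [← ENNReal.ofReal_mul (by positivity), ← ENNReal.ofReal_add ht0.le
                (mul_nonneg (by positivity) (pow_nonneg (logGrad_nonneg F y) n))]
              exact ENNReal.ofReal_le_ofReal (le_add_zpow_mul_pow hn (logGrad_nonneg F y) ht0)
          _ = ENNReal.ofReal t * radialMeasure n (dyadicShell n k) +
              ENNReal.ofReal ((t ^ (n - 1))⁻¹) *
                ∫⁻ y in dyadicShell n k, ENNReal.ofReal (logGrad F y ^ n) ∂(radialMeasure n) := by
              rw [lintegral_add_left measurable_const, setLIntegral_const,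
                lintegral_const_mul' _ _ ENNReal.ofReal_ne_top]
          _ ≤ ENNReal.ofReal t * (sphMeasure n univ * ENNReal.ofReal ((1 / 2) ^ (k + 1))) +
              ENNReal.ofReal ((t ^ (n - 1))⁻¹) *
                (c * ENNReal.ofReal (E * ((1 / 2) ^ (k + 1)) ^ (-b))) := by
              refine add_le_add (mul_le_mul_right (radialMeasure_dyadicShell_le n k) _)
                (mul_le_mul_right ?_ _)
              calc ∫⁻ y in dyadicShell n k, ENNReal.ofReal (logGrad F y ^ n) ∂(radialMeasure n)
                  ≤ ∫⁻ y in ball 0 (1 - (1 / 2) ^ (k + 1)), ENNReal.ofReal (logGrad F y ^ n)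
                      ∂(radialMeasure n) := by
                    refine lintegral_mono_set fun y hy => ?_
                    rw [mem_ball_zero_iff]
                    exact hy.2
                _ ≤ ∫⁻ y in ball 0 (1 - (1 / 2) ^ (k + 1)), ENNReal.ofReal (logGrad F y ^ n)
                      ∂(c • (volume : Measure (Vec n))) :=
                    lintegral_mono' (Measure.restrict_mono subset_rfl hc) le_rfl
                _ = c * ∫⁻ y in ball (0 : Vec n) (1 - (1 / 2) ^ (k + 1)),
                      ENNReal.ofReal (logGrad F y ^ n) := by
                    rw [Measure.restrict_smul, lintegral_smul_measure]
                    rfl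
                _ ≤ _ := by
                    refine mul_le_mul_right ?_ _
                    have := hen F hF (1 - (1 / 2) ^ (k + 1)) (by linarith) (by linarith)
                    rwa [sub_sub_cancel] at this
          _ ≤ _ := by
              have hk2 : ((1 : ℝ) / 2) ^ (k + 1) = 2 ^ (-((k : ℝ) + 1)) := by
                rw [one_div, inv_pow, Real.rpow_neg (by norm_num)]
                congr 1
                exact_mod_cast (Real.rpow_natCast 2 (k + 1)).symm
              refine add_le_add ?_ ?_
              · rw [mul_left_comm, ← ENNReal.ofReal_mul ht0.le, ← ENNReal.ofReal_pow hq₁0.le]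
                refine mul_le_mul_right (ENNReal.ofReal_le_ofReal ?_) _
                rw [hk2, ht, hq₁, ← Real.rpow_add (by norm_num), ← Real.rpow_mul_natCast (by norm_num)]
                exact Real.rpow_le_rpow_of_exponent_le (by norm_num) (by linarith)
              · rw [mul_left_comm, mul_assoc, ← ENNReal.ofReal_mul (by positivity),
                  ← ENNReal.ofReal_pow hq₂0.le, ← ENNReal.ofReal_mul (by positivity)]
                refine mul_le_mul_right (ENNReal.ofReal_le_ofReal (le_of_eq ?_)) _
                have hcast : ((n - 1 : ℕ) : ℝ) = (n : ℝ) - 1 := by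
                  rw [Nat.cast_sub (by lia)]; simp
                rw [hk2, ht, hq₂, ← Real.rpow_mul_natCast (by norm_num),
                  ← Real.rpow_mul_natCast (by norm_num), ← Real.rpow_neg (by norm_num),
                  ← Real.rpow_mul (by norm_num), hcast, mul_left_comm, mul_assoc,
                  ← Real.rpow_add (by norm_num), mul_assoc E, ← Real.rpow_add (by norm_num)]
                congr 2
                ring

/-- Along a radius, the logarithm of the modulus decreases at most by the radial variation. -/
lemma norm_half_le_exp_mul_norm {n : ℕ} {K C₀ α a C₁ : ℝ} {F : Vec n → Vec n}
    (hF : IsCentered n K C₀ α a C₁ F) {ω : Vec n} (hω : ω ∈ unitSphere n) {V : ℝ}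
    (hV : ∫⁻ t in Ioo (1 / 2 : ℝ) 1, ENNReal.ofReal (logGrad F (t • ω)) ≤ ENNReal.ofReal V)
    (hV0 : 0 ≤ V) {s : ℝ} (hs : s ∈ Ioo (1 / 2 : ℝ) 1) :
    ‖F ((1 / 2 : ℝ) • ω)‖ ≤ Real.exp V * ‖F (s • ω)‖ := by
  have hωn : ‖ω‖ = 1 := by simpa [unitSphere] using hω
  have hmem : ∀ t ∈ Icc (1 / 2 : ℝ) s, t • ω ∈ unitBall n := by
    intro t ht
    rw [unitBall, mem_ball_zero_iff, norm_smul, hωn, mul_one,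
      Real.norm_of_nonneg (by linarith [ht.1])]
    linarith [ht.2, hs.2]
  have hline : ∀ t : ℝ, HasDerivAt (fun t : ℝ => t • ω) ω t := fun t => by
    simpa using (hasDerivAt_id t).smul_const ω
  have hder : ∀ t ∈ Icc (1 / 2 : ℝ) s, HasDerivAt (fun t : ℝ => F (t • ω))
      (fderiv ℝ F (t • ω) ω) t := fun t ht =>
    (hF.differentiableAt _ (hmem t ht)).hasFDerivAt.comp_hasDerivAt t (hline t)
  set g : ℝ → ℝ := fun t => -(1 / 2) * Real.log (‖F (t • ω)‖ ^ 2) with hg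
  set g' : ℝ → ℝ := fun t => -(1 / 2) *
    ((2 * inner ℝ (F (t • ω)) (fderiv ℝ F (t • ω) ω)) / ‖F (t • ω)‖ ^ 2) with hg'
  have hpos : ∀ t ∈ Icc (1 / 2 : ℝ) s, 0 < ‖F (t • ω)‖ := fun t ht =>
    norm_pos_iff.mpr (hF.ne_zero _ (hmem t ht))
  have hgd : ∀ t ∈ Icc (1 / 2 : ℝ) s, HasDerivAt g (g' t) t := fun t ht =>
    (((hder t ht).norm_sq).log (pow_pos (hpos t ht) 2).ne').const_mul _
  have hint : IntegrableOn (fun t => logGrad F (t • ω)) (Icc (1 / 2) s) := by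
    have hm : Measurable fun t : ℝ => logGrad F (t • ω) :=
      (measurable_logGrad hF.measurable).comp (by fun_prop)
    rw [integrableOn_Icc_iff_integrableOn_Ioo]
    refine ⟨hm.aestronglyMeasurable, ?_⟩
    rw [hasFiniteIntegral_iff_ofReal (ae_of_all _ fun t => logGrad_nonneg F _)]
    refine (lintegral_mono_set (Ioo_subset_Ioo le_rfl hs.2.le)).trans_lt
      (hV.trans_lt ENNReal.ofReal_lt_top)
  have hbound : ∀ t ∈ Ioo (1 / 2 : ℝ) s, g' t ≤ logGrad F (t • ω) := by
    intro t ht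
    have hp := hpos t (Ioo_subset_Icc_self ht)
    have h1 : |inner ℝ (F (t • ω)) (fderiv ℝ F (t • ω) ω)| ≤
        ‖F (t • ω)‖ * ‖fderiv ℝ F (t • ω)‖ := by
      refine (abs_real_inner_le_norm _ _).trans ?_
      gcongr
      have := (fderiv ℝ F (t • ω)).le_opNorm ω
      rwa [hωn, mul_one] at this
    have h2 := (abs_le.mp h1).1
    simp only [hg', logGrad]
    rw [show -(1 / 2 : ℝ) * (2 * inner ℝ (F (t • ω)) (fderiv ℝ F (t • ω) ω) /
      ‖F (t • ω)‖ ^ 2) = (-inner ℝ (F (t • ω)) (fderiv ℝ F (t • ω) ω)) / ‖F (t • ω)‖ ^ 2 by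
        ring, div_le_div_iff₀ (by positivity) hp]
    nlinarith
  have hmain := intervalIntegral.sub_le_integral_of_hasDeriv_right_of_le hs.1.le
    (fun t ht => (hgd t ht).continuousAt.continuousWithinAt)
    (fun t ht => (hgd t (Ioo_subset_Icc_self ht)).hasDerivWithinAt) hint hbound
  have hint_le : ∫ t in (1 / 2 : ℝ)..s, logGrad F (t • ω) ≤ V := by
    rw [intervalIntegral.integral_of_le hs.1.le, integral_Ioc_eq_integral_Ioo,
      integral_eq_lintegral_of_nonneg_ae (ae_of_all _ fun t => logGrad_nonneg F _)
      (hint.mono_set Ioo_subset_Icc_self).aestronglyMeasurable]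
    refine ENNReal.toReal_le_of_le_ofReal hV0 (le_trans ?_ hV)
    exact lintegral_mono_set (Ioo_subset_Ioo le_rfl hs.2.le)
  have hps := hpos s (right_mem_Icc.mpr hs.1.le)
  have hph := hpos (1 / 2) (left_mem_Icc.mpr hs.1.le)
  have hl : Real.log ‖F ((1 / 2 : ℝ) • ω)‖ ≤ V + Real.log ‖F (s • ω)‖ := by
    simp only [hg, Real.log_pow] at hmain
    push_cast at hmain
    linarith
  rw [← Real.exp_log hph, ← Real.exp_log hps, ← Real.exp_add, Real.exp_log hph]
  rw [← Real.exp_log hph]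
  exact Real.exp_le_exp.mpr hl

/-- The point inverse to `x` with respect to the unit sphere. -/
def invCenter {n : ℕ} (x : Vec n) : Vec n := (‖x‖ ^ 2)⁻¹ • x

/-- The inversion that preserves the unit ball and interchanges `0` and `x`. -/
def ballInv {n : ℕ} (x : Vec n) : Vec n → Vec n :=
  EuclideanGeometry.inversion (invCenter x) (√((‖x‖ ^ 2)⁻¹ - 1))

section ballInv

variable {n : ℕ} {x : Vec n}

lemma norm_invCenter (x : Vec n) : ‖invCenter x‖ = ‖x‖⁻¹ := by
  rcases eq_or_ne x 0 with rfl | h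
  · simp [invCenter]
  · have := norm_pos_iff.mpr h
    rw [invCenter, norm_smul, norm_inv, norm_pow, norm_norm]
    field_simp

lemma one_lt_inv_norm_sq (hx0 : x ≠ 0) (hx : ‖x‖ < 1) : 1 < (‖x‖ ^ 2)⁻¹ := by
  have := norm_pos_iff.mpr hx0
  exact (one_lt_inv₀ (by positivity)).mpr (by nlinarith)

lemma ne_invCenter (hx0 : x ≠ 0) (hx : ‖x‖ < 1) {y : Vec n} (hy : ‖y‖ ≤ 1) :
    y ≠ invCenter x := by
  rintro rfl
  rw [norm_invCenter] at hy
  have := (one_lt_inv₀ (norm_pos_iff.mpr hx0)).mpr hx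
  linarith

lemma norm_sub_invCenter_pos (hx0 : x ≠ 0) (hx : ‖x‖ < 1) {y : Vec n} (hy : ‖y‖ ≤ 1) :
    0 < ‖y - invCenter x‖ :=
  norm_pos_iff.mpr (sub_ne_zero.mpr (ne_invCenter hx0 hx hy))

lemma ballInv_apply (hx0 : x ≠ 0) (hx : ‖x‖ < 1) (y : Vec n) :
    ballInv x y = (((‖x‖ ^ 2)⁻¹ - 1) / ‖y - invCenter x‖ ^ 2) • (y - invCenter x) +
      invCenter x := by
  rw [ballInv, EuclideanGeometry.inversion, dist_eq_norm, div_pow,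
    Real.sq_sqrt (by linarith [one_lt_inv_norm_sq hx0 hx])]
  rfl

lemma radius_ne_zero (hx0 : x ≠ 0) (hx : ‖x‖ < 1) : √((‖x‖ ^ 2)⁻¹ - 1) ≠ 0 :=
  (Real.sqrt_pos.mpr (by linarith [one_lt_inv_norm_sq hx0 hx])).ne'

lemma ballInv_ballInv (hx0 : x ≠ 0) (hx : ‖x‖ < 1) (y : Vec n) : ballInv x (ballInv x y) = y :=
  EuclideanGeometry.inversion_inversion _ (radius_ne_zero hx0 hx) y

lemma norm_sub_invCenter_sq (x y : Vec n) (hx0 : x ≠ 0) :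
    ‖y - invCenter x‖ ^ 2 = ‖y‖ ^ 2 - 2 * inner ℝ x y / ‖x‖ ^ 2 + (‖x‖ ^ 2)⁻¹ := by
  have := norm_pos_iff.mpr hx0
  rw [norm_sub_sq_real, norm_invCenter, invCenter, real_inner_smul_right, real_inner_comm]
  field_simp

lemma one_sub_norm_ballInv_sq (hx0 : x ≠ 0) (hx : ‖x‖ < 1) {y : Vec n} (hy : ‖y‖ ≤ 1) :
    1 - ‖ballInv x y‖ ^ 2 =
      ((‖x‖ ^ 2)⁻¹ - 1) * (1 - ‖y‖ ^ 2) / ‖y - invCenter x‖ ^ 2 := by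
  have hD := norm_sub_invCenter_pos hx0 hx hy
  have hxp := norm_pos_iff.mpr hx0
  have hi : inner ℝ (y - invCenter x) (invCenter x) =
      inner ℝ x y / ‖x‖ ^ 2 - (‖x‖ ^ 2)⁻¹ := by
    rw [inner_sub_left, real_inner_self_eq_norm_sq, norm_invCenter, invCenter,
      real_inner_smul_right, real_inner_comm]
    field_simp
  have hD2 := norm_sub_invCenter_sq x y hx0
  rw [ballInv_apply hx0 hx, norm_add_sq_real, norm_smul, real_inner_smul_left, hi, norm_invCenter,
    Real.norm_eq_abs, mul_pow, sq_abs]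
  have hD' : ‖y - invCenter x‖ ^ 2 ≠ 0 := by positivity
  generalize ‖y - invCenter x‖ ^ 2 = D at *
  have hb : inner ℝ x y / ‖x‖ ^ 2 = (‖y‖ ^ 2 + (‖x‖ ^ 2)⁻¹ - D) / 2 := by
    rw [hD2]; ring
  rw [hb, inv_pow]
  field_simp
  ring

lemma norm_ballInv_lt_one (hx0 : x ≠ 0) (hx : ‖x‖ < 1) {y : Vec n} (hy : ‖y‖ < 1) :
    ‖ballInv x y‖ < 1 := by
  have h := one_sub_norm_ballInv_sq hx0 hx hy.le
  have hD := norm_sub_invCenter_pos hx0 hx hy.le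
  have hs := one_lt_inv_norm_sq hx0 hx
  have : 0 < ((‖x‖ ^ 2)⁻¹ - 1) * (1 - ‖y‖ ^ 2) / ‖y - invCenter x‖ ^ 2 := by
    have : ‖y‖ ^ 2 < 1 := by nlinarith [norm_nonneg y]
    have : 0 < 1 - ‖y‖ ^ 2 := by linarith
    have : 0 < (‖x‖ ^ 2)⁻¹ - 1 := by linarith
    positivity
  nlinarith [norm_nonneg (ballInv x y)]

lemma norm_ballInv_eq_one (hx0 : x ≠ 0) (hx : ‖x‖ < 1) {y : Vec n} (hy : ‖y‖ = 1) :
    ‖ballInv x y‖ = 1 := by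
  have h := one_sub_norm_ballInv_sq hx0 hx hy.le
  rw [hy] at h
  have : ‖ballInv x y‖ ^ 2 = 1 := by
    simp at h; linarith
  nlinarith [norm_nonneg (ballInv x y)]

lemma ballInv_mem_unitBall (hx0 : x ≠ 0) (hx : ‖x‖ < 1) {y : Vec n} (hy : y ∈ unitBall n) :
    ballInv x y ∈ unitBall n := by
  simp only [unitBall, mem_ball_zero_iff] at *
  exact norm_ballInv_lt_one hx0 hx hy

lemma ballInv_mem_unitSphere (hx0 : x ≠ 0) (hx : ‖x‖ < 1) {y : Vec n} (hy : y ∈ unitSphere n) :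
    ballInv x y ∈ unitSphere n := by
  simp only [unitSphere, mem_sphere_zero_iff_norm] at *
  exact norm_ballInv_eq_one hx0 hx hy

lemma dist_ballInv_ballInv (hx0 : x ≠ 0) (hx : ‖x‖ < 1) {y z : Vec n} (hy : ‖y‖ ≤ 1)
    (hz : ‖z‖ ≤ 1) :
    ‖ballInv x y - ballInv x z‖ =
      ((‖x‖ ^ 2)⁻¹ - 1) / (‖y - invCenter x‖ * ‖z - invCenter x‖) * ‖y - z‖ := by
  have := EuclideanGeometry.dist_inversion_inversion (ne_invCenter hx0 hx hy)
    (ne_invCenter hx0 hx hz) (√((‖x‖ ^ 2)⁻¹ - 1))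
  rw [Real.sq_sqrt (by linarith [one_lt_inv_norm_sq hx0 hx])] at this
  simp only [dist_eq_norm] at this
  exact this

lemma ballInv_zero (hx0 : x ≠ 0) (hx : ‖x‖ < 1) : ballInv x 0 = x := by
  have := norm_pos_iff.mpr hx0
  rw [ballInv_apply hx0 hx, zero_sub, norm_neg, norm_invCenter, invCenter]
  match_scalars
  field_simp
  ring

/-- The reflection in the hyperplane orthogonal to `x`. -/
def orthReflection (x : Vec n) : Vec n ≃ₗᵢ[ℝ] Vec n := (ℝ ∙ x)ᗮ.reflection

lemma orthReflection_apply (x y : Vec n) :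
    orthReflection x y = y - (2 * inner ℝ x y / ‖x‖ ^ 2) • x := by
  rw [orthReflection, Submodule.reflection_orthogonal_apply, Submodule.reflection_singleton_apply,
    neg_sub, ← Nat.cast_smul_eq_nsmul ℝ, smul_smul]
  simp [mul_div_assoc]

/-- The Möbius automorphism is the inversion followed by a reflection. -/
lemma mobiusT_neg_orthReflection (hx0 : x ≠ 0) (hx : ‖x‖ < 1) {y : Vec n} (hy : ‖y‖ ≤ 1) :
    mobiusT n (-x) (orthReflection x y) = ballInv x y := by
  have hxp := norm_pos_iff.mpr hx0
  have hD := norm_sub_invCenter_pos hx0 hx hy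
  have hrx : orthReflection x x = -x := by
    rw [orthReflection_apply, real_inner_self_eq_norm_sq, mul_div_assoc,
      div_self (by positivity), mul_one, two_smul]
    abel
  have h1 : ‖orthReflection x y - (-x)‖ = ‖y - x‖ := by
    rw [← hrx, ← map_sub, LinearIsometryEquiv.norm_map]
  have h2 : ‖orthReflection x y - (‖x‖ ^ 2)⁻¹ • (-x)‖ = ‖y - invCenter x‖ := by
    rw [← hrx, ← map_smul, ← map_sub, LinearIsometryEquiv.norm_map, invCenter]
  rw [mobiusT, if_neg (neg_ne_zero.mpr hx0), norm_neg, h1, h2, ballInv_apply hx0 hx]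
  have hDsq := norm_sub_invCenter_sq x y hx0
  have hyx : ‖y - x‖ ^ 2 = ‖y‖ ^ 2 - 2 * inner ℝ x y + ‖x‖ ^ 2 := by
    rw [norm_sub_sq_real, real_inner_comm]
  have hD' : ‖y - invCenter x‖ ^ 2 ≠ 0 := by positivity
  rw [hyx]
  generalize ‖y - invCenter x‖ ^ 2 = D at *
  have hy2 : ‖y‖ ^ 2 = D + 2 * inner ℝ x y / ‖x‖ ^ 2 - (‖x‖ ^ 2)⁻¹ := by rw [hDsq]; ring
  rw [hy2, orthReflection_apply, invCenter]
  match_scalars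
  · field_simp
  · field_simp
    ring

lemma norm_orthReflection (x y : Vec n) : ‖orthReflection x y‖ = ‖y‖ :=
  LinearIsometryEquiv.norm_map _ _

lemma hasFDerivAt_ballInv (hx0 : x ≠ 0) (hx : ‖x‖ < 1) {y : Vec n} (hy : ‖y‖ ≤ 1) :
    ∃ c : ℝ, 0 < c ∧ ∃ R : Vec n ≃ₗᵢ[ℝ] Vec n,
      HasFDerivAt (ballInv x) (c • (R : Vec n →L[ℝ] Vec n)) y := by
  refine ⟨_, ?_, _, EuclideanGeometry.hasFDerivAt_inversion (ne_invCenter hx0 hx hy)⟩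
  have := dist_pos.mpr (ne_invCenter hx0 hx hy)
  have := (radius_ne_zero hx0 hx).symm.lt_of_le (Real.sqrt_nonneg _)
  positivity

lemma abs_det_linearIsometryEquiv (R : Vec n ≃ₗᵢ[ℝ] Vec n) :
    |(R : Vec n →L[ℝ] Vec n).det| = 1 := by
  have h2 := Measure.addHaar_image_linearMap (volume : Measure (Vec n))
    (R.toLinearEquiv.toLinearMap) (ball 0 1)
  have h3 : (R.toLinearEquiv.toLinearMap) '' (ball (0 : Vec n) 1) = ball 0 1 := by
    have := R.image_ball 0 1
    rwa [map_zero] at this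
  rw [h3] at h2
  have hb0 : (volume : Measure (Vec n)) (ball 0 1) ≠ 0 := (measure_ball_pos _ _ one_pos).ne'
  have hbt : (volume : Measure (Vec n)) (ball 0 1) ≠ ⊤ := measure_ball_lt_top.ne
  have h4 : ENNReal.ofReal |LinearMap.det (R.toLinearEquiv.toLinearMap)| = 1 := by
    rw [eq_comm] at h2
    exact (ENNReal.mul_eq_right hb0 hbt).mp h2
  exact ENNReal.ofReal_eq_one.mp h4

lemma continuousOn_ballInv (hx0 : x ≠ 0) (hx : ‖x‖ < 1) :
    ContinuousOn (ballInv x) (unitBall n) := fun y hy => by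
  obtain ⟨c, -, R, h⟩ := hasFDerivAt_ballInv hx0 hx (y := y)
    (by simp [unitBall] at hy; exact hy.le)
  exact h.continuousAt.continuousWithinAt

end ballInv

/-- Recentering a map at `x`, by precomposition with the inversion that moves `0` to `x`. -/
def recenter {n : ℕ} (f : Vec n → Vec n) (x : Vec n) : Vec n → Vec n :=
  (unitBall n).indicator (f ∘ ballInv x)

lemma recenter_apply {n : ℕ} (f : Vec n → Vec n) (x : Vec n) {y : Vec n} (hy : y ∈ unitBall n) :
    recenter f x y = f (ballInv x y) :=
  indicator_of_mem hy _

lemma exists_reflected_eq {n : ℕ} {x : Vec n} (hx0 : x ≠ 0) (hx : ‖x‖ < 1) {y : Vec n}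
    (hy : y ∈ unitBall n) :
    ∃ w ∈ unitBall n, ‖w‖ = ‖y‖ ∧ mobiusT n (-x) w = ballInv x y := by
  have hy1 : ‖y‖ < 1 := by simpa [unitBall] using hy
  refine ⟨orthReflection x y, ?_, norm_orthReflection x y,
    mobiusT_neg_orthReflection hx0 hx hy1.le⟩
  rwa [unitBall, mem_ball_zero_iff, norm_orthReflection]

lemma isCentered_recenter {n : ℕ} {K C₀ α a C₁ : ℝ} (hK : 1 ≤ K) {f : Vec n → Vec n}
    (hf : IsQR n K f) (hf0 : ∀ x ∈ unitBall n, f x ≠ 0)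
    (hMin : InMiniowitz n C₀ α f) (hM : MultCond n a C₁ f) {x : Vec n} (hx0 : x ≠ 0)
    (hx : ‖x‖ < 1) : IsCentered n K C₀ α a C₁ (recenter f x) := by
  have hxB : x ∈ unitBall n := by simpa [unitBall] using hx
  have h0B : (0 : Vec n) ∈ unitBall n := by simp [unitBall]
  have hmT0 : mobiusT n (-x) 0 = x := by
    rw [← map_zero (orthReflection x), mobiusT_neg_orthReflection hx0 hx (by simp),
      ballInv_zero hx0 hx]
  have hB0 := ballInv_zero hx0 hx
  have hmaps : MapsTo (ballInv x) (unitBall n) (unitBall n) := fun y hy =>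
    ballInv_mem_unitBall hx0 hx hy
  have hev : ∀ y ∈ unitBall n, recenter f x =ᶠ[𝓝 y] f ∘ ballInv x := fun y hy => by
    filter_upwards [isOpen_ball.mem_nhds hy] with z hz using recenter_apply f x hz
  have hD : ∀ y ∈ unitBall n, ∃ c : ℝ, 0 < c ∧ ∃ R : Vec n ≃ₗᵢ[ℝ] Vec n,
      HasFDerivAt (recenter f x)
        ((fderiv ℝ f (ballInv x y)).comp (c • (R : Vec n →L[ℝ] Vec n))) y := fun y hy => by
    obtain ⟨c, hc, R, h⟩ := hasFDerivAt_ballInv hx0 hx (y := y)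
      (by simp [unitBall] at hy; exact hy.le)
    refine ⟨c, hc, R, HasFDerivAt.congr_of_eventuallyEq ?_ (hev y hy)⟩
    exact (hf.2.1 _ (hmaps hy)).hasFDerivAt.comp y h
  have hmin := fun (y : Vec n) (hy : y ∈ unitBall n) => show
      C₀⁻¹ * ((1 - ‖y‖) / (1 + ‖y‖)) ^ α ≤ ‖recenter f x y‖ / ‖recenter f x 0‖ ∧
      ‖recenter f x y‖ / ‖recenter f x 0‖ ≤ C₀ * ((1 + ‖y‖) / (1 - ‖y‖)) ^ α by
    obtain ⟨w, hw, hwn, hwe⟩ := exists_reflected_eq hx0 hx hy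
    have := hMin x hxB w hw
    rw [hmT0] at this
    rwa [recenter_apply f x hy, recenter_apply f x h0B, ← hwe, ← hwn, hB0]
  refine ⟨?_, fun y hy => ?_, fun y hy => ?_, ?_, fun y hy => (hmin y hy).1,
    fun y hy => (hmin y hy).2, fun r hr0 hr1 y => ?_⟩
  · have : ContinuousOn (f ∘ ballInv x) (unitBall n) :=
      hf.1.comp (continuousOn_ballInv hx0 hx) hmaps
    rw [recenter, ← piecewise_eq_indicator]
    exact this.measurable_piecewise continuousOn_const measurableSet_ball
  · obtain ⟨c, -, R, h⟩ := hD y hy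
    exact h.differentiableAt
  · rw [recenter_apply f x hy]
    exact hf0 _ (hmaps hy)
  · have hq := hf.2.2
    rw [unitBall, ae_restrict_iff' measurableSet_ball] at hq ⊢
    rw [ae_iff] at hq
    have himg := addHaar_image_eq_zero_of_differentiableOn_of_addHaar_eq_zero
      (volume : Measure (Vec n)) (f := ballInv x) (s := {y | ¬(y ∈ unitBall n →
        ‖fderiv ℝ f y‖ ^ n ≤ K * (fderiv ℝ f y).det)}) (fun y hy => by
        simp only [mem_ofPred_eq, Classical.not_imp] at hy
        obtain ⟨c, -, R, h⟩ := hasFDerivAt_ballInv hx0 hx (y := y)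
          (by simpa [unitBall] using (mem_ball_zero_iff.mp hy.1).le)
        exact h.differentiableAt.differentiableWithinAt) hq
    rw [ae_iff]
    refine measure_mono_null (fun y hy => ?_) himg
    simp only [mem_ofPred_eq, Classical.not_imp] at hy
    obtain ⟨hyB, hy⟩ := hy
    refine ⟨ballInv x y, ?_, ballInv_ballInv hx0 hx y⟩
    simp only [mem_ofPred_eq, Classical.not_imp]
    refine ⟨hmaps hyB, fun hle => hy ?_⟩
    obtain ⟨c, hc, R, h⟩ := hD y hyB
    rw [h.fderiv]
    have hdet : |((fderiv ℝ f (ballInv x y)).comp (c • (R : Vec n →L[ℝ] Vec n))).det| =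
        |(fderiv ℝ f (ballInv x y)).det| * c ^ n := by
      have h1 := abs_det_linearIsometryEquiv R
      simp only [ContinuousLinearMap.det, ContinuousLinearMap.toLinearMap_comp,
        ContinuousLinearMap.toLinearMap_smul, LinearMap.det_comp, LinearMap.det_smul] at h1 ⊢
      rw [abs_mul, abs_mul, h1, mul_one, finrank_euclideanSpace_fin, abs_of_pos (pow_pos hc n)]
    have hnorm : ‖(fderiv ℝ f (ballInv x y)).comp (c • (R : Vec n →L[ℝ] Vec n))‖ ≤
        ‖fderiv ℝ f (ballInv x y)‖ * c := by
      refine (ContinuousLinearMap.opNorm_comp_le _ _).trans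
        (mul_le_mul_of_nonneg_left ?_ (norm_nonneg _))
      refine ContinuousLinearMap.opNorm_le_bound _ hc.le fun v => ?_
      simp [norm_smul, abs_of_pos hc]
    rw [hdet]
    calc _ ≤ (‖fderiv ℝ f (ballInv x y)‖ * c) ^ n := pow_le_pow_left₀ (norm_nonneg _) hnorm n
      _ = ‖fderiv ℝ f (ballInv x y)‖ ^ n * c ^ n := mul_pow _ _ _
      _ ≤ K * (fderiv ℝ f (ballInv x y)).det * c ^ n := by gcongr
      _ ≤ K * |(fderiv ℝ f (ballInv x y)).det| * c ^ n := by gcongr; exact le_abs_self _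
      _ = _ := by ring
  · refine le_trans ?_ (hM x hxB r hr0 hr1 y)
    have hsub : ∀ z ∈ ball (0 : Vec n) r, z ∈ unitBall n := fun z hz =>
      ball_subset_ball hr1.le hz
    have : ({z ∈ ball (0 : Vec n) r | recenter f x z = y}).encard ≤
        ({z ∈ ball (0 : Vec n) r | f (mobiusT n (-x) z) = y}).encard := by
      rw [← (orthReflection x).injective.encard_image]
      refine encard_le_encard ?_
      rintro _ ⟨z, ⟨hz, hzy⟩, rfl⟩
      have hzB := hsub z hz
      refine ⟨?_, ?_⟩
      · rw [mem_ball_zero_iff] at hz ⊢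
        rwa [norm_orthReflection]
      · rw [mobiusT_neg_orthReflection hx0 hx (mem_ball_zero_iff.mp hzB).le, ← hzy,
          recenter_apply f x hzB]
    exact_mod_cast this

section boundary

variable {n : ℕ} {x : Vec n}

/-- Radii are mapped by a Möbius transformation to curves that approach the sphere
non-tangentially, for every aperture. -/
lemma tendsto_ballInv_radius (hx0 : x ≠ 0) (hx : ‖x‖ < 1) {κ : ℝ} (hκ : 0 < κ) {η : Vec n}
    (hη : ‖η‖ = 1) :
    Tendsto (fun t : ℝ => ballInv x (t • η)) (𝓝[<] 1)
      (𝓝[ntRegion n κ (ballInv x η)] (ballInv x η)) := by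
  have hline : Tendsto (fun t : ℝ => t • η) (𝓝 1) (𝓝 η) := by
    have : Continuous fun t : ℝ => t • η := by fun_prop
    simpa using this.tendsto 1
  have hI : Tendsto (fun t : ℝ => ballInv x (t • η)) (𝓝 1) (𝓝 (ballInv x η)) := by
    obtain ⟨c, -, R, h⟩ := hasFDerivAt_ballInv hx0 hx hη.le
    exact h.continuousAt.tendsto.comp hline
  refine tendsto_nhdsWithin_iff.mpr ⟨hI.mono_left nhdsWithin_le_nhds, ?_⟩
  have hD := norm_sub_invCenter_pos hx0 hx hη.le
  have hIη := norm_ballInv_eq_one hx0 hx hη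
  have hl : Tendsto (fun t : ℝ => (1 + ‖ballInv x (t • η)‖) * ‖t • η - invCenter x‖) (𝓝 1)
      (𝓝 ((1 + 1) * ‖η - invCenter x‖)) := by
    have := (hI.norm.const_add 1).mul (hline.sub_const (invCenter x)).norm
    rwa [hIη] at this
  have hr : Tendsto (fun t : ℝ => (1 + κ) * (1 + t) * ‖η - invCenter x‖) (𝓝 1)
      (𝓝 ((1 + κ) * (1 + 1) * ‖η - invCenter x‖)) := by
    refine Continuous.tendsto (f := fun t : ℝ => (1 + κ) * (1 + t) * ‖η - invCenter x‖) ?_ 1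
    fun_prop
  have hlt := hl.eventually_lt hr (by nlinarith [mul_pos hκ hD])
  filter_upwards [nhdsWithin_le_nhds hlt, self_mem_nhdsWithin,
    nhdsWithin_le_nhds (Ioi_mem_nhds (zero_lt_one' ℝ))] with t ht ht1 ht0
  have ht1' : t < 1 := ht1
  have ht0' : 0 < t := ht0
  have htn : ‖t • η‖ = t := by rw [norm_smul, hη, mul_one, Real.norm_of_nonneg ht0'.le]
  have hIt := norm_ballInv_lt_one hx0 hx (htn.trans_lt ht1')
  refine ⟨by simpa [unitBall] using hIt, ?_⟩
  have htη : ‖t • η - η‖ = 1 - t := by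
    rw [show t • η - η = (t - 1) • η by rw [sub_smul, one_smul], norm_smul, hη, mul_one,
      Real.norm_of_nonpos (by linarith)]
    ring
  have hDt := norm_sub_invCenter_pos hx0 hx (htn.trans_lt ht1').le
  have hsq := one_sub_norm_ballInv_sq hx0 hx (htn.trans_lt ht1').le
  have hs : 0 < (‖x‖ ^ 2)⁻¹ - 1 := by linarith [one_lt_inv_norm_sq hx0 hx]
  have hdist := dist_ballInv_ballInv hx0 hx (htn.trans_lt ht1').le hη.le
  rw [htn] at hsq
  have h1 : 1 - ‖ballInv x (t • η)‖ = ((‖x‖ ^ 2)⁻¹ - 1) * (1 - t ^ 2) /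
      ‖t • η - invCenter x‖ ^ 2 / (1 + ‖ballInv x (t • η)‖) := by
    rw [← hsq, eq_div_iff (by positivity)]
    ring
  have hpos : 0 < 1 + ‖ballInv x (t • η)‖ := by positivity
  rw [hdist, htη, h1]
  generalize 1 + ‖ballInv x (t • η)‖ = b at *
  generalize ‖t • η - invCenter x‖ = d at *
  generalize ‖η - invCenter x‖ = e at *
  generalize (‖x‖ ^ 2)⁻¹ - 1 = s at hs ⊢
  have hc : 0 < s * (1 - t) / (d * d * e * b) := by
    have : 0 < 1 - t := by linarith
    positivity
  calc s / (d * e) * (1 - t) = s * (1 - t) / (d * d * e * b) * (b * d) := by field_simp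
    _ < s * (1 - t) / (d * d * e * b) * ((1 + κ) * (1 + t) * e) := mul_lt_mul_of_pos_left ht hc
    _ = _ := by field_simp; ring

/-- A bound of the value at `x` by the boundary values at points where the radial variation of
the recentered map is controlled. -/
lemma norm_le_mul_norm_of_hasNTLimit {K C₀ α a C₁ κ : ℝ} (hC₀ : 1 ≤ C₀) (hκ : 0 < κ)
    {f : Vec n → Vec n} (hx0 : x ≠ 0) (hx : ‖x‖ < 1)
    (hF : IsCentered n K C₀ α a C₁ (recenter f x)) {η ℓ : Vec n} (hη : η ∈ unitSphere n)
    {V : ℝ} (hV0 : 0 ≤ V)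
    (hV : ∫⁻ t in Ioo (1 / 2 : ℝ) 1, ENNReal.ofReal (logGrad (recenter f x) (t • η)) ≤
      ENNReal.ofReal V) (hlim : HasNTLimit n κ f (ballInv x η) ℓ) :
    ‖f x‖ ≤ (C₀ * 3 ^ α * Real.exp V) * ‖ℓ‖ := by
  have hηn : ‖η‖ = 1 := by simpa [unitSphere] using hη
  have h0B : (0 : Vec n) ∈ unitBall n := by simp [unitBall]
  have hmem : ∀ t ∈ Ioo (0 : ℝ) 1, t • η ∈ unitBall n := fun t ht => by
    rw [unitBall, mem_ball_zero_iff, norm_smul, hηn, mul_one, Real.norm_of_nonneg ht.1.le]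
    exact ht.2
  have hF0 : recenter f x 0 = f x := by rw [recenter_apply f x h0B, ballInv_zero hx0 hx]
  have hhalf : ‖f x‖ ≤ C₀ * 3 ^ α * ‖recenter f x ((1 / 2 : ℝ) • η)‖ := by
    have h := hF.lower _ (hmem (1 / 2) (by norm_num))
    have hpos : 0 < ‖f x‖ := by
      rw [← hF0]
      exact norm_pos_iff.mpr (hF.ne_zero _ h0B)
    rw [hF0, norm_smul, hηn, mul_one, show (1 - ‖(1 / 2 : ℝ)‖) / (1 + ‖(1 / 2 : ℝ)‖) = 3⁻¹ by
      norm_num, Real.inv_rpow (by norm_num), le_div_iff₀ hpos] at h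
    calc ‖f x‖ = C₀ * 3 ^ α * (C₀⁻¹ * ((3 : ℝ) ^ α)⁻¹ * ‖f x‖) := by field_simp
      _ ≤ _ := by gcongr
  have hrad := hlim.comp (tendsto_ballInv_radius hx0 hx hκ hηn)
  refine ge_of_tendsto (hrad.norm.const_mul _) ?_
  filter_upwards [Ioo_mem_nhdsLT (show (1 / 2 : ℝ) < 1 by norm_num)] with t ht
  have h := norm_half_le_exp_mul_norm hF hη hV hV0 ht
  rw [recenter_apply f x (hmem t ⟨by linarith [ht.1], ht.2⟩)] at h
  calc ‖f x‖ ≤ _ := hhalf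
    _ ≤ C₀ * 3 ^ α * (Real.exp V * ‖f (ballInv x (t • η))‖) := by gcongr
    _ = _ := by simp only [Function.comp_apply]; ring

lemma norm_sub_invCenter_le_three (hx2 : 1 / 2 ≤ ‖x‖) {y : Vec n} (hy : ‖y‖ ≤ 1) :
    ‖y - invCenter x‖ ≤ 3 := by
  have h1 := norm_sub_le y (invCenter x)
  rw [norm_invCenter] at h1
  have : ‖x‖⁻¹ ≤ 2 := by
    rw [inv_le_comm₀ (by linarith) two_pos]
    linarith
  linarith

lemma one_sub_le_inv_norm_sq_sub_one (hx2 : 1 / 2 ≤ ‖x‖) (hx : ‖x‖ < 1) :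
    1 - ‖x‖ ≤ (‖x‖ ^ 2)⁻¹ - 1 := by
  have hp : 0 < ‖x‖ := by linarith
  rw [le_sub_iff_add_le, ← one_div, le_div_iff₀ (by positivity)]
  nlinarith [mul_pos hp hp, mul_pos (mul_pos hp hp) (sub_pos.mpr hx), sq_nonneg (‖x‖ - 1)]

/-- The inversion does not contract subsets of the sphere by more than a factor comparable to
the distance of `x` to the sphere. -/
lemma sphMeasure_le_ballInv_image (hn : 2 ≤ n) (hx2 : 1 / 2 ≤ ‖x‖) (hx : ‖x‖ < 1) {Q : Set (Vec n)}
    (hQ : Q ⊆ unitSphere n) :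
    sphMeasure n Q ≤ ENNReal.ofReal ((9 / (1 - ‖x‖)) ^ (n - 1)) *
      sphMeasure n (ballInv x '' Q) := by
  have hx0 : x ≠ 0 := norm_pos_iff.mp (by linarith)
  have hnorm : ∀ y ∈ Q, ‖y‖ ≤ 1 := fun y hy => by
    have : ‖y‖ = 1 := by simpa [unitSphere] using hQ hy
    exact this.le
  have hd : (0 : ℝ) ≤ (n : ℝ) - 1 := by
    have : (2 : ℝ) ≤ n := by exact_mod_cast hn
    linarith
  have hL : 0 ≤ 9 / (1 - ‖x‖) := div_nonneg (by norm_num) (by linarith)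
  have hmeas : MeasurableSet (unitSphere n) := isClosed_sphere.measurableSet
  have himg : ballInv x '' Q ⊆ unitSphere n := by
    rintro _ ⟨y, hy, rfl⟩
    exact ballInv_mem_unitSphere hx0 hx (hQ hy)
  have key := hausdorffMeasure_le_image (9 / (1 - ‖x‖)).toNNReal hd (ballInv x) Q
    (fun y hy z hz => by
      have hs := one_sub_le_inv_norm_sq_sub_one hx2 hx
      have hDy := norm_sub_invCenter_pos hx0 hx (hnorm y hy)
      have hDz := norm_sub_invCenter_pos hx0 hx (hnorm z hz)
      have h3y := norm_sub_invCenter_le_three hx2 (hnorm y hy)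
      have h3z := norm_sub_invCenter_le_three hx2 (hnorm z hz)
      rw [dist_eq_norm, dist_eq_norm, dist_ballInv_ballInv hx0 hx (hnorm y hy) (hnorm z hz),
        Real.coe_toNNReal _ hL, ← mul_assoc]
      refine le_mul_of_one_le_left (norm_nonneg _) ?_
      rw [div_mul_div_comm, one_le_div (mul_pos (by linarith) (by positivity))]
      have : ‖y - invCenter x‖ * ‖z - invCenter x‖ ≤ 9 := by nlinarith
      nlinarith)
  rw [sphMeasure, Measure.restrict_eq_self _ hQ, Measure.restrict_eq_self _ himg]
  refine key.trans (le_of_eq ?_)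
  congr 1
  rw [show ((9 / (1 - ‖x‖)).toNNReal : ℝ≥0∞) = ENNReal.ofReal (9 / (1 - ‖x‖)) from rfl,
    ENNReal.ofReal_rpow_of_nonneg hL hd]
  congr 1
  rw [← Real.rpow_natCast, Nat.cast_sub (by lia), Nat.cast_one]

end boundary

lemma norm_ballInv_sub_self {n : ℕ} {x : Vec n} (hx0 : x ≠ 0) (hx : ‖x‖ < 1) {η : Vec n}
    (hη : ‖η‖ = 1) :
    ‖ballInv x η - x‖ = (1 - ‖x‖ ^ 2) / (‖x‖ * ‖η - invCenter x‖) := by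
  have h := dist_ballInv_ballInv hx0 hx hη.le (z := 0) (by simp)
  have hp := norm_pos_iff.mpr hx0
  have hD := norm_sub_invCenter_pos hx0 hx hη.le
  rw [ballInv_zero hx0 hx, sub_zero, zero_sub, norm_neg, norm_invCenter, hη] at h
  rw [h]
  field_simp

/-- The value of `f` at `x` is controlled by the mean of the boundary values over a cap whose
radius is comparable to the distance of `x` to the sphere. -/
lemma exists_pow_norm_le_average (n : ℕ) (hn : 2 ≤ n) (K C₀ α a C₁ κ p : ℝ)
    (hK : 1 ≤ K) (hC₀ : 1 ≤ C₀) (hα : 0 < α) (ha0 : 0 ≤ a) (ha : a < (n : ℝ) - 1)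
    (hC₁ : 0 < C₁) (hκ : 0 < κ) (hp : 0 < p)
    (f : Vec n → Vec n) (hf : IsQR n K f) (hf0 : ∀ x ∈ unitBall n, f x ≠ 0)
    (hMin : InMiniowitz n C₀ α f) (hM : MultCond n a C₁ f)
    (g : Vec n → Vec n) (hg : ∀ᵐ ω ∂(sphMeasure n), HasNTLimit n κ f ω (g ω))
    (hgm : AEStronglyMeasurable g (sphMeasure n)) (hσ : sphMeasure n univ ≠ 0) :
    ∃ C : ℝ≥0∞, C ≠ ⊤ ∧ ∃ L : ℝ, 0 < L ∧ ∀ x : Vec n, 1 / 2 ≤ ‖x‖ → ‖x‖ < 1 →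
      ENNReal.ofReal (‖f x‖ ^ p) * ENNReal.ofReal ((1 - ‖x‖) ^ (n - 1)) ≤
        C * ∫⁻ ζ in closedBall x (L * (1 - ‖x‖)), ENNReal.ofReal (‖g ζ‖ ^ p) ∂(sphMeasure n) := by
  have hfin := isFiniteMeasure_sphMeasure n hn
  set m := sphMeasure n univ with hm
  have hmt : m ≠ ⊤ := measure_ne_top _ _
  have hm3 : m / 3 ≠ 0 := by simp [hσ]
  have hm3t : m / 3 ≠ ⊤ := (ENNReal.div_lt_top hmt (by norm_num)).ne
  obtain ⟨CV, hCVt, hCV⟩ := exists_radial_variation_bound n hn K C₀ α a C₁ hK hC₀ hα ha0 ha hC₁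
  obtain ⟨A, hA, hcap⟩ := sphMeasure_closedBall_le n hn
  obtain ⟨V, hV0, hV⟩ : ∃ V : ℝ, 0 < V ∧ CV / ENNReal.ofReal V ≤ m / 3 := by
    have hq : CV / (m / 3) ≠ ⊤ := (ENNReal.div_lt_top hCVt hm3).ne
    refine ⟨(CV / (m / 3)).toReal + 1, by positivity, ?_⟩
    rw [ENNReal.div_le_iff_le_mul (Or.inr hm3t) (Or.inl ENNReal.ofReal_ne_top)]
    · have : CV / (m / 3) ≤ ENNReal.ofReal ((CV / (m / 3)).toReal + 1) := by
        rw [ENNReal.le_ofReal_iff_toReal_le hq (by positivity)]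
        linarith
      calc CV = (m / 3) * (CV / (m / 3)) := (ENNReal.mul_div_cancel hm3 hm3t).symm
        _ ≤ _ := by gcongr
  obtain ⟨L, hL0, hL⟩ : ∃ L : ℝ, 0 < L ∧ ENNReal.ofReal (A * (3 / L) ^ (n - 1)) ≤ m / 3 := by
    have h1 : Tendsto (fun L : ℝ => ENNReal.ofReal (A * (3 / L) ^ (n - 1))) atTop (𝓝 0) := by
      have h2 : Tendsto (fun L : ℝ => A * (3 / L) ^ (n - 1)) atTop (𝓝 (A * 0 ^ (n - 1))) :=
        ((tendsto_id.const_div_atTop 3).pow _).const_mul A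
      rw [zero_pow (by lia), mul_zero] at h2
      simpa using ENNReal.tendsto_ofReal h2
    have h3 := h1.eventually_lt_const (pos_iff_ne_zero.mpr hm3)
    obtain ⟨L, hL, hL0⟩ := (h3.and (eventually_gt_atTop 0)).exists
    exact ⟨L, hL0, hL.le⟩
  set D : ℝ := C₀ * 3 ^ α * Real.exp V with hD
  have hD0 : 0 < D := by positivity
  refine ⟨ENNReal.ofReal (9 ^ (n - 1)) * ENNReal.ofReal (D ^ p) / (m / 3),
    (ENNReal.div_lt_top (ENNReal.mul_ne_top ENNReal.ofReal_ne_top ENNReal.ofReal_ne_top) hm3).ne,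
    L, hL0, fun x hx2 hx => ?_⟩
  have hx0 : x ≠ 0 := norm_pos_iff.mp (by linarith)
  have hxp : 0 < ‖x‖ := by linarith
  have hx1 : 0 < 1 - ‖x‖ := by linarith
  have hF := isCentered_recenter hK hf hf0 hMin hM hx0 hx
  set W : Vec n → ℝ≥0∞ := fun η =>
    ∫⁻ t in Ioo (1 / 2 : ℝ) 1, ENNReal.ofReal (logGrad (recenter f x) (t • η)) with hW
  have hWm : Measurable W := by
    refine Measurable.lintegral_prod_right'
      (f := fun q : Vec n × ℝ => ENNReal.ofReal (logGrad (recenter f x) (q.2 • q.1))) ?_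
    exact ((measurable_logGrad hF.measurable).comp (by fun_prop)).ennreal_ofReal
  set N : Set (Vec n) := {ω | ¬HasNTLimit n κ f ω (g ω)} with hN
  set Q : Set (Vec n) := {η ∈ unitSphere n | W η ≤ ENNReal.ofReal V ∧
    η ∉ closedBall (invCenter x) (3 / L) ∧ HasNTLimit n κ f (ballInv x η) (g (ballInv x η))} with hQ
  have hQS : Q ⊆ unitSphere n := fun η hη => hη.1
  have hbad1 : sphMeasure n {η | ENNReal.ofReal V ≤ W η} ≤ m / 3 := by
    refine le_trans ?_ hV
    refine (meas_ge_le_lintegral_div hWm.aemeasurable (by simpa using hV0)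
      ENNReal.ofReal_ne_top).trans ?_
    gcongr
    exact hCV _ hF
  have hbad2 : sphMeasure n (closedBall (invCenter x) (3 / L)) ≤ m / 3 :=
    (hcap _ _ (by positivity)).trans hL
  have hbad3 : sphMeasure n {η ∈ unitSphere n | ballInv x η ∈ N} = 0 := by
    refine le_antisymm ((sphMeasure_le_ballInv_image hn hx2 hx fun η hη => hη.1).trans ?_) zero_le
    have : sphMeasure n (ballInv x '' {η ∈ unitSphere n | ballInv x η ∈ N}) = 0 :=
      measure_mono_null (by rintro _ ⟨η, hη, rfl⟩; exact hη.2) (ae_iff.mp hg)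
    rw [this, mul_zero]
  have hsphc : sphMeasure n (unitSphere n)ᶜ = 0 := ae_iff.mp (ae_mem_unitSphere n)
  have hQm : m / 3 ≤ sphMeasure n Q := by
    have hcover : (univ : Set (Vec n)) ⊆ Q ∪ {η | ENNReal.ofReal V ≤ W η} ∪
        closedBall (invCenter x) (3 / L) ∪ {η ∈ unitSphere n | ballInv x η ∈ N} ∪
        (unitSphere n)ᶜ := by
      intro η _
      by_cases h1 : η ∈ unitSphere n
      · by_cases h2 : ENNReal.ofReal V ≤ W η
        · simp [h2]
        · by_cases h3 : η ∈ closedBall (invCenter x) (3 / L)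
          · exact Or.inl (Or.inl (Or.inr h3))
          · by_cases h4 : ballInv x η ∈ N
            · exact Or.inl (Or.inr ⟨h1, h4⟩)
            · exact Or.inl (Or.inl (Or.inl (Or.inl ⟨h1, (not_le.mp h2).le, h3, not_not.mp h4⟩)))
      · exact Or.inr h1
    have h1 : m ≤ sphMeasure n Q + m / 3 + m / 3 :=
      calc m ≤ sphMeasure n Q + sphMeasure n {η | ENNReal.ofReal V ≤ W η} +
            sphMeasure n (closedBall (invCenter x) (3 / L)) +
            sphMeasure n {η ∈ unitSphere n | ballInv x η ∈ N} + sphMeasure n (unitSphere n)ᶜ :=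
          (measure_mono hcover).trans <| (measure_union_le _ _).trans <| add_le_add_left
            ((measure_union_le _ _).trans <| add_le_add_left
            ((measure_union_le _ _).trans <| add_le_add_left (measure_union_le _ _) _) _) _
        _ ≤ _ := by
          rw [hbad3, hsphc, add_zero, add_zero]
          gcongr
    have h2 : m / 3 + m / 3 + m / 3 = m := ENNReal.add_thirds m
    rw [← h2] at h1
    exact (ENNReal.add_le_add_iff_right hm3t).mp ((ENNReal.add_le_add_iff_right hm3t).mp
      (by rwa [h2] at h1 ⊢))
  have himg : ballInv x '' Q ⊆ {ζ | ENNReal.ofReal (‖f x‖ ^ p) ≤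
      ENNReal.ofReal (D ^ p) * ENNReal.ofReal (‖g ζ‖ ^ p)} ∩ closedBall x (L * (1 - ‖x‖)) := by
    rintro _ ⟨η, ⟨hη, hηV, hηc, hηN⟩, rfl⟩
    have hηn : ‖η‖ = 1 := by simpa [unitSphere] using hη
    refine ⟨?_, ?_⟩
    · have := norm_le_mul_norm_of_hasNTLimit hC₀ hκ hx0 hx hF hη hV0.le hηV hηN
      change ENNReal.ofReal _ ≤ _
      rw [← ENNReal.ofReal_mul (by positivity), ← Real.mul_rpow hD0.le (norm_nonneg _)]
      exact ENNReal.ofReal_le_ofReal (Real.rpow_le_rpow (norm_nonneg _) this hp.le)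
    · rw [mem_closedBall, dist_eq_norm, norm_ballInv_sub_self hx0 hx hηn]
      rw [mem_closedBall, dist_eq_norm, not_le, div_lt_iff₀ hL0] at hηc
      have hDp := norm_sub_invCenter_pos hx0 hx hηn.le
      rw [div_le_iff₀ (by positivity)]
      have : 1 + ‖x‖ ≤ L * (‖x‖ * ‖η - invCenter x‖) := by nlinarith
      nlinarith
  set E := closedBall x (L * (1 - ‖x‖)) with hE
  have hgm' : AEMeasurable (fun ζ => ENNReal.ofReal (‖g ζ‖ ^ p)) (sphMeasure n) :=
    (hgm.norm.aemeasurable.pow_const p).ennreal_ofReal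
  have hmarkov : ENNReal.ofReal (‖f x‖ ^ p) * sphMeasure n (ballInv x '' Q) ≤
      ENNReal.ofReal (D ^ p) * ∫⁻ ζ in E, ENNReal.ofReal (‖g ζ‖ ^ p) ∂(sphMeasure n) := by
    rw [← lintegral_const_mul' _ _ ENNReal.ofReal_ne_top]
    refine le_trans ?_ (mul_meas_ge_le_lintegral₀ (hgm'.restrict.const_mul _)
      (ENNReal.ofReal (‖f x‖ ^ p)))
    refine mul_le_mul_right ?_ _
    rw [Measure.restrict_apply' isClosed_closedBall.measurableSet]
    exact measure_mono himg
  have hlow : ENNReal.ofReal ((1 - ‖x‖) ^ (n - 1)) * (m / 3) ≤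
      ENNReal.ofReal (9 ^ (n - 1)) * sphMeasure n (ballInv x '' Q) := by
    have := mul_le_mul_right (hQm.trans (sphMeasure_le_ballInv_image hn hx2 hx hQS))
      (ENNReal.ofReal ((1 - ‖x‖) ^ (n - 1)))
    rwa [← mul_assoc, ← ENNReal.ofReal_mul (by positivity), ← mul_pow,
      mul_div_cancel₀ _ hx1.ne'] at this
  rw [ENNReal.div_eq_inv_mul, mul_assoc, ← ENNReal.div_eq_inv_mul,
    ENNReal.le_div_iff_mul_le (Or.inl hm3) (Or.inl hm3t)]
  calc _ = ENNReal.ofReal (‖f x‖ ^ p) * (ENNReal.ofReal ((1 - ‖x‖) ^ (n - 1)) * (m / 3)) :=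
        mul_assoc _ _ _
    _ ≤ ENNReal.ofReal (‖f x‖ ^ p) *
        (ENNReal.ofReal (9 ^ (n - 1)) * sphMeasure n (ballInv x '' Q)) := by gcongr
    _ = ENNReal.ofReal (9 ^ (n - 1)) *
        (ENNReal.ofReal (‖f x‖ ^ p) * sphMeasure n (ballInv x '' Q)) := mul_left_comm _ _ _
    _ ≤ _ := by
        rw [mul_assoc]
        exact mul_le_mul_right hmarkov _

lemma aestronglyMeasurable_comp_radius {n : ℕ} {f : Vec n → Vec n}
    (hf : ContinuousOn f (unitBall n)) {r : ℝ} (hr : r ∈ Ioo (0 : ℝ) 1) :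
    AEStronglyMeasurable (fun ω => f (r • ω)) (sphMeasure n) := by
  refine ContinuousOn.aestronglyMeasurable (hf.comp (by fun_prop) fun ω hω => ?_)
    isClosed_sphere.measurableSet
  have : ‖ω‖ = 1 := by simpa [unitSphere] using hω
  rw [unitBall, mem_ball_zero_iff, norm_smul, this, mul_one, Real.norm_of_nonneg hr.1.le]
  exact hr.2

lemma HasNTLimit.tendsto_radius {n : ℕ} {κ : ℝ} (hκ : 0 < κ) {f : Vec n → Vec n} {ω ℓ : Vec n}
    (h : HasNTLimit n κ f ω ℓ) (hω : ω ∈ unitSphere n) :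
    Tendsto (fun r : ℝ => f (r • ω)) (𝓝[<] 1) (𝓝 ℓ) := by
  have hωn : ‖ω‖ = 1 := by simpa [unitSphere] using hω
  refine h.comp (tendsto_nhdsWithin_iff.mpr ⟨?_, ?_⟩)
  · have : Continuous fun t : ℝ => t • ω := by fun_prop
    simpa using (this.tendsto 1).mono_left nhdsWithin_le_nhds
  · filter_upwards [Ioo_mem_nhdsLT (zero_lt_one' ℝ)] with r hr
    have hn : ‖r • ω‖ = r := by rw [norm_smul, hωn, mul_one, Real.norm_of_nonneg hr.1.le]
    refine ⟨by simpa [unitBall, hn] using hr.2, ?_⟩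
    rw [hn, show r • ω - ω = (r - 1) • ω by rw [sub_smul, one_smul], norm_smul, hωn, mul_one,
      Real.norm_of_nonpos (by linarith [hr.2])]
    nlinarith [mul_pos hκ (sub_pos.mpr hr.2)]

/-- Integrating a function over caps, and then over the centers of the caps. -/
lemma lintegral_lintegral_closedBall_le {n : ℕ} [IsFiniteMeasure (sphMeasure n)] {A : ℝ}
    (hA : ∀ z r, 0 ≤ r → sphMeasure n (closedBall z r) ≤ ENNReal.ofReal (A * r ^ (n - 1)))
    {h : Vec n → ℝ≥0∞} (hh : AEMeasurable h (sphMeasure n)) {r ρ : ℝ} (hr : r ≤ 1)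
    (hρ : 0 ≤ ρ) :
    ∫⁻ ω, (∫⁻ ζ in closedBall (r • ω) ρ, h ζ ∂(sphMeasure n)) ∂(sphMeasure n) ≤
      ENNReal.ofReal (A * (ρ + (1 - r)) ^ (n - 1)) * ∫⁻ ζ, h ζ ∂(sphMeasure n) := by
  set S : Set (Vec n × Vec n) := {q | dist q.2 (r • q.1) ≤ ρ} with hS
  have hSm : MeasurableSet S := (isClosed_le (by fun_prop) continuous_const).measurableSet
  have hmeas : AEMeasurable (Function.uncurry fun ω ζ => S.indicator (fun q => h q.2) (ω, ζ))
      ((sphMeasure n).prod (sphMeasure n)) :=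
    (hh.comp_quasiMeasurePreserving Measure.quasiMeasurePreserving_snd).indicator hSm
  calc _ = ∫⁻ ω, (∫⁻ ζ, S.indicator (fun q => h q.2) (ω, ζ) ∂(sphMeasure n)) ∂(sphMeasure n) := by
        refine lintegral_congr fun ω => ?_
        rw [← lintegral_indicator isClosed_closedBall.measurableSet]
        rfl
    _ = ∫⁻ ζ, (∫⁻ ω, S.indicator (fun q => h q.2) (ω, ζ) ∂(sphMeasure n)) ∂(sphMeasure n) :=
        lintegral_lintegral_swap hmeas
    _ ≤ ∫⁻ ζ, ENNReal.ofReal (A * (ρ + (1 - r)) ^ (n - 1)) * h ζ ∂(sphMeasure n) := by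
        refine lintegral_mono fun ζ => ?_
        calc ∫⁻ ω, S.indicator (fun q => h q.2) (ω, ζ) ∂(sphMeasure n)
            ≤ ∫⁻ ω, (closedBall ζ (ρ + (1 - r))).indicator (fun _ => h ζ) ω ∂(sphMeasure n) := by
              refine lintegral_mono_ae ?_
              filter_upwards [ae_mem_unitSphere n] with ω hω
              have hωn : ‖ω‖ = 1 := by simpa [unitSphere] using hω
              by_cases hmem : (ω, ζ) ∈ S
              · have hd : dist ζ (r • ω) ≤ ρ := hmem
                have h1 : dist (r • ω) ω = 1 - r := by
                  rw [dist_eq_norm, show r • ω - ω = (r - 1) • ω by rw [sub_smul, one_smul],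
                    norm_smul, hωn, mul_one, Real.norm_of_nonpos (by linarith)]
                  ring
                have h2 : ω ∈ closedBall ζ (ρ + (1 - r)) := by
                  rw [mem_closedBall, dist_comm]
                  linarith [dist_triangle ζ (r • ω) ω]
                rw [indicator_of_mem hmem, indicator_of_mem h2]
              · rw [indicator_of_notMem hmem]
                exact zero_le
          _ = h ζ * sphMeasure n (closedBall ζ (ρ + (1 - r))) := by
              rw [lintegral_indicator_const isClosed_closedBall.measurableSet]
          _ ≤ _ := by
              rw [mul_comm]
              gcongr
              exact hA _ _ (by linarith)
    _ = _ := lintegral_const_mul' _ _ ENNReal.ofReal_ne_top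

lemma ofReal_norm_sub_rpow_le {E : Type*} [SeminormedAddCommGroup E] {p : ℝ} (hp : 0 < p)
    (u v : E) :
    ENNReal.ofReal (‖u - v‖ ^ p) ≤
      ENNReal.ofReal (2 ^ p) * (ENNReal.ofReal (‖u‖ ^ p) + ENNReal.ofReal (‖v‖ ^ p)) := by
  rw [← ENNReal.ofReal_add (by positivity) (by positivity), ← ENNReal.ofReal_mul (by positivity)]
  refine ENNReal.ofReal_le_ofReal ?_
  have key : ∀ s t : ℝ, 0 ≤ s → s ≤ t → (s + t) ^ p ≤ 2 ^ p * t ^ p := fun s t hs hst => by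
    rw [← Real.mul_rpow (by norm_num) (hs.trans hst)]
    exact Real.rpow_le_rpow (by linarith) (by linarith) hp.le
  have h1 : ‖u - v‖ ^ p ≤ (‖u‖ + ‖v‖) ^ p :=
    Real.rpow_le_rpow (norm_nonneg _) (norm_sub_le u v) hp.le
  have hu : 0 ≤ 2 ^ p * ‖u‖ ^ p := by positivity
  have hv : 0 ≤ 2 ^ p * ‖v‖ ^ p := by positivity
  rcases le_total ‖u‖ ‖v‖ with h | h
  · linarith [key _ _ (norm_nonneg _) h]
  · rw [add_comm] at h1
    linarith [key _ _ (norm_nonneg _) h]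

lemma tendsto_lintegral_tsub_natCast {β : Type*} [MeasurableSpace β] {μ : Measure β}
    {h : β → ℝ≥0∞} (hh : AEMeasurable h μ) (hfin : ∫⁻ x, h x ∂μ ≠ ⊤) :
    Tendsto (fun M : ℕ => ∫⁻ x, (h x - M) ∂μ) atTop (𝓝 0) := by
  have := tendsto_lintegral_of_dominated_convergence' (μ := μ) (F := fun (M : ℕ) x => h x - M)
    (f := fun _ => 0) h (fun M => hh.sub aemeasurable_const)
    (fun M => ae_of_all _ fun x => tsub_le_self) hfin (by
      filter_upwards [ae_lt_top' hh hfin] with x hx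
      refine tendsto_const_nhds.congr' ?_
      obtain ⟨N, hN⟩ := ENNReal.exists_nat_gt hx.ne
      filter_upwards [eventually_ge_atTop N] with M hM
      exact (tsub_eq_zero_of_le (hN.le.trans (by exact_mod_cast hM))).symm)
  simpa using this

/-- A function that is controlled by cap averages of `h` is, on the sphere of radius `r`, bounded
up to a function whose mean is controlled by the tail of `h`, uniformly in `r`. -/
lemma exists_tail_decomposition (n : ℕ) (hn : 2 ≤ n) {u h : Vec n → ℝ≥0∞}
    (hh : AEMeasurable h (sphMeasure n)) {C : ℝ≥0∞} (hC : C ≠ ⊤) {L : ℝ} (hL : 0 < L)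
    (hu : ∀ x : Vec n, 1 / 2 ≤ ‖x‖ → ‖x‖ < 1 → u x * ENNReal.ofReal ((1 - ‖x‖) ^ (n - 1)) ≤
      C * ∫⁻ ζ in closedBall x (L * (1 - ‖x‖)), h ζ ∂(sphMeasure n)) :
    ∃ C' C'' : ℝ≥0∞, C' ≠ ⊤ ∧ C'' ≠ ⊤ ∧ ∀ r ∈ Ioo (1 / 2 : ℝ) 1, ∀ M : ℕ, ∃ G : Vec n → ℝ≥0∞,
      (∀ ω ∈ unitSphere n, u (r • ω) ≤ C' * M + G ω) ∧
      ∫⁻ ω, G ω ∂(sphMeasure n) ≤ C'' * ∫⁻ ζ, (h ζ - M) ∂(sphMeasure n) := by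
  have hfin := isFiniteMeasure_sphMeasure n hn
  obtain ⟨A, hA, hcap⟩ := sphMeasure_closedBall_le n hn
  refine ⟨C * ENNReal.ofReal (A * L ^ (n - 1)), C * ENNReal.ofReal (A * (L + 1) ^ (n - 1)),
    ENNReal.mul_ne_top hC ENNReal.ofReal_ne_top, ENNReal.mul_ne_top hC ENNReal.ofReal_ne_top,
    fun r hr M => ?_⟩
  have hr1 : 0 < 1 - r := by linarith [hr.2]
  set c : ℝ≥0∞ := ENNReal.ofReal ((1 - r) ^ (n - 1)) with hc
  have hc0 : c ≠ 0 := by simpa [hc] using pow_pos hr1 _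
  have hct : c ≠ ⊤ := ENNReal.ofReal_ne_top
  have hscale : ∀ s : ℝ, 0 ≤ s →
      ENNReal.ofReal (A * (s * (1 - r)) ^ (n - 1)) = ENNReal.ofReal (A * s ^ (n - 1)) * c := by
    intro s hs
    rw [hc, ← ENNReal.ofReal_mul (by positivity), mul_pow, mul_assoc]
  refine ⟨fun ω => C * c⁻¹ * ∫⁻ ζ in closedBall (r • ω) (L * (1 - r)), (h ζ - M) ∂(sphMeasure n),
    fun ω hω => ?_, ?_⟩
  · have hωn : ‖ω‖ = 1 := by simpa [unitSphere] using hω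
    have hrn : ‖r • ω‖ = r := by
      rw [norm_smul, hωn, mul_one, Real.norm_of_nonneg (by linarith [hr.1])]
    have key := hu (r • ω) (by rw [hrn]; exact hr.1.le) (by rw [hrn]; exact hr.2)
    rw [hrn] at key
    set E := closedBall (r • ω) (L * (1 - r)) with hE
    have hint : ∫⁻ ζ in E, h ζ ∂(sphMeasure n) ≤
        M * (ENNReal.ofReal (A * L ^ (n - 1)) * c) + ∫⁻ ζ in E, (h ζ - M) ∂(sphMeasure n) :=
      calc ∫⁻ ζ in E, h ζ ∂(sphMeasure n)
          ≤ ∫⁻ ζ in E, ((M : ℝ≥0∞) + (h ζ - M)) ∂(sphMeasure n) :=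
            lintegral_mono fun ζ => le_add_tsub
        _ = M * sphMeasure n E + ∫⁻ ζ in E, (h ζ - M) ∂(sphMeasure n) := by
            rw [lintegral_add_left measurable_const, setLIntegral_const]
        _ ≤ _ := by
            rw [← hscale L hL.le]
            gcongr
            exact hcap _ _ (by positivity)
    calc u (r • ω) = u (r • ω) * c * c⁻¹ := by
          rw [mul_assoc, ENNReal.mul_inv_cancel hc0 hct, mul_one]
      _ ≤ C * (M * (ENNReal.ofReal (A * L ^ (n - 1)) * c) +
            ∫⁻ ζ in E, (h ζ - M) ∂(sphMeasure n)) * c⁻¹ := by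
          exact mul_le_mul' (key.trans (mul_le_mul' le_rfl hint)) le_rfl
      _ = C * ENNReal.ofReal (A * L ^ (n - 1)) * M * (c * c⁻¹) +
            C * c⁻¹ * ∫⁻ ζ in E, (h ζ - M) ∂(sphMeasure n) := by ring
      _ = _ := by rw [ENNReal.mul_inv_cancel hc0 hct, mul_one]
  · rw [lintegral_const_mul' _ _ (ENNReal.mul_ne_top hC (ENNReal.inv_ne_top.mpr hc0))]
    calc _ ≤ C * c⁻¹ * (ENNReal.ofReal (A * (L * (1 - r) + (1 - r)) ^ (n - 1)) *
          ∫⁻ ζ, (h ζ - M) ∂(sphMeasure n)) := by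
          gcongr
          exact lintegral_lintegral_closedBall_le hcap (hh.sub aemeasurable_const) hr.2.le
            (by positivity)
      _ = C * ENNReal.ofReal (A * (L + 1) ^ (n - 1)) * (c * c⁻¹) *
          ∫⁻ ζ, (h ζ - M) ∂(sphMeasure n) := by
          rw [show L * (1 - r) + (1 - r) = (L + 1) * (1 - r) by ring, hscale _ (by positivity)]
          ring
      _ = _ := by rw [ENNReal.mul_inv_cancel hc0 hct, mul_one]

/-- A dominated convergence theorem for dominating functions with uniformly small tails. -/
lemma tendsto_lintegral_of_tail_decomposition {β : Type*} [MeasurableSpace β] {μ : Measure β}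
    [IsFiniteMeasure μ] {d : ℝ → β → ℝ≥0∞} {h : β → ℝ≥0∞}
    (hd : ∀ r ∈ Ioo (1 / 2 : ℝ) 1, AEMeasurable (d r) μ)
    (hlim : ∀ᵐ x ∂μ, Tendsto (fun r => d r x) (𝓝[<] 1) (𝓝 0))
    (hh : AEMeasurable h μ) (hfin : ∫⁻ x, h x ∂μ ≠ ⊤) {c C' C'' : ℝ≥0∞} (hc : c ≠ ⊤)
    (hC' : C' ≠ ⊤) (hC'' : C'' ≠ ⊤)
    (hdec : ∀ r ∈ Ioo (1 / 2 : ℝ) 1, ∀ M : ℕ, ∃ G : β → ℝ≥0∞,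
      (∀ᵐ x ∂μ, d r x ≤ c * (C' * M + G x + h x)) ∧
      ∫⁻ x, G x ∂μ ≤ C'' * ∫⁻ x, (h x - M) ∂μ) :
    Tendsto (fun r => ∫⁻ x, d r x ∂μ) (𝓝[<] 1) (𝓝 0) := by
  have hev : ∀ᶠ r : ℝ in 𝓝[<] 1, r ∈ Ioo (1 / 2 : ℝ) 1 := Ioo_mem_nhdsLT (by norm_num)
  rw [ENNReal.tendsto_nhds_zero]
  intro ε hε
  have hε2 : 0 < ε / 2 := ENNReal.half_pos hε.ne'
  obtain ⟨M, hM⟩ : ∃ M : ℕ, c * (C'' * ∫⁻ x, (h x - M) ∂μ) ≤ ε / 2 := by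
    have h1 := ENNReal.Tendsto.const_mul (ENNReal.Tendsto.const_mul
      (tendsto_lintegral_tsub_natCast hh hfin) (Or.inr hC'')) (Or.inr hc)
    rw [mul_zero, mul_zero] at h1
    exact (h1.eventually_le_const hε2).exists
  set b : β → ℝ≥0∞ := fun x => c * (C' * M + h x) with hb
  have hbm : AEMeasurable b μ := (hh.const_add _).const_mul _
  have hbfin : ∫⁻ x, b x ∂μ ≠ ⊤ := by
    rw [hb, lintegral_const_mul' _ _ hc, lintegral_add_left measurable_const, lintegral_const]
    exact ENNReal.mul_ne_top hc (ENNReal.add_ne_top.mpr ⟨ENNReal.mul_ne_top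
      (ENNReal.mul_ne_top hC' (ENNReal.natCast_ne_top M)) (measure_ne_top _ _), hfin⟩)
  have hmin : Tendsto (fun r => ∫⁻ x, min (d r x) (b x) ∂μ) (𝓝[<] 1) (𝓝 0) := by
    have := tendsto_lintegral_filter_of_dominated_convergence' (μ := μ) (l := 𝓝[<] (1 : ℝ))
      (F := fun r x => min (d r x) (b x)) (f := fun _ => 0) b
      (hev.mono fun r hr => (hd r hr).min hbm)
      (Eventually.of_forall fun r => ae_of_all _ fun x => min_le_right _ _) hbfin (by
        filter_upwards [hlim] with x hx
        exact tendsto_of_tendsto_of_tendsto_of_le_of_le tendsto_const_nhds hx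
          (fun r => zero_le) (fun r => min_le_left _ _))
    simpa using this
  filter_upwards [hev, hmin.eventually_le_const hε2] with r hr hr2
  obtain ⟨G, hG, hGint⟩ := hdec r hr M
  calc ∫⁻ x, d r x ∂μ ≤ ∫⁻ x, (min (d r x) (b x) + c * G x) ∂μ := by
        refine lintegral_mono_ae ?_
        filter_upwards [hG] with x hx
        rcases le_total (d r x) (b x) with h1 | h1
        · rw [min_eq_left h1]
          exact le_self_add
        · rw [min_eq_right h1]
          refine hx.trans (le_of_eq ?_)
          simp only [hb]
          ring
    _ = ∫⁻ x, min (d r x) (b x) ∂μ + c * ∫⁻ x, G x ∂μ := by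
        rw [lintegral_add_left' ((hd r hr).min hbm), lintegral_const_mul' _ _ hc]
    _ ≤ ε / 2 + ε / 2 := add_le_add hr2 ((mul_le_mul_right hGint c).trans hM)
    _ = ε := ENNReal.add_halves ε

theorem boundary_lp_convergence (n : ℕ) (hn : 2 ≤ n) (K C₀ α a C₁ κ p : ℝ)
    (hK : 1 ≤ K) (hC₀ : 1 ≤ C₀) (hα : 0 < α) (ha0 : 0 ≤ a) (ha : a < (n : ℝ) - 1)
    (hC₁ : 0 < C₁) (hκ : 0 < κ) (hp : 0 < p)
    (f : Vec n → Vec n) (hf : IsQR n K f) (hf0 : ∀ x ∈ unitBall n, f x ≠ 0)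
    (hMin : InMiniowitz n C₀ α f) (hM : MultCond n a C₁ f)
    (g : Vec n → Vec n) (hg : ∀ᵐ ω ∂(sphMeasure n), HasNTLimit n κ f ω (g ω))
    (hgLp : lpSphere n p g < ⊤) :
    Filter.Tendsto
      (fun r : ℝ => ∫⁻ ω, ENNReal.ofReal (‖f (r • ω) - g ω‖ ^ p) ∂(sphMeasure n))
      (𝓝[<] (1 : ℝ)) (𝓝 0) := by
  have hfin := isFiniteMeasure_sphMeasure n hn
  by_cases hσ : sphMeasure n univ = 0
  · rw [Measure.measure_univ_eq_zero] at hσ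
    simp [hσ]
  have hrad : ∀ᵐ ω ∂(sphMeasure n), Tendsto (fun r : ℝ => f (r • ω)) (𝓝[<] 1) (𝓝 (g ω)) := by
    filter_upwards [hg, ae_mem_unitSphere n] with ω h1 h2 using h1.tendsto_radius hκ h2
  have hgm : AEStronglyMeasurable g (sphMeasure n) := by
    obtain ⟨r, -, hr, hrlim⟩ := exists_seq_strictMono_tendsto' (zero_lt_one' ℝ)
    refine aestronglyMeasurable_of_tendsto_ae atTop
      (fun k => aestronglyMeasurable_comp_radius hf.1 (hr k)) ?_
    filter_upwards [hrad] with ω hω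
    exact hω.comp (tendsto_nhdsWithin_iff.mpr ⟨hrlim, Eventually.of_forall fun k => (hr k).2⟩)
  have hh : AEMeasurable (fun ω => ENNReal.ofReal (‖g ω‖ ^ p)) (sphMeasure n) :=
    (hgm.norm.aemeasurable.pow_const p).ennreal_ofReal
  have hhfin : ∫⁻ ω, ENNReal.ofReal (‖g ω‖ ^ p) ∂(sphMeasure n) ≠ ⊤ :=
    ((ENNReal.rpow_lt_top_iff_of_pos (one_div_pos.mpr hp)).mp hgLp).ne
  obtain ⟨C, hC, L, hL, hu⟩ := exists_pow_norm_le_average n hn K C₀ α a C₁ κ p hK hC₀ hα ha0 ha hC₁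
    hκ hp f hf hf0 hMin hM g hg hgm hσ
  obtain ⟨C', C'', hC', hC'', hdec⟩ := exists_tail_decomposition n hn
    (u := fun x => ENNReal.ofReal (‖f x‖ ^ p)) hh hC hL hu
  refine tendsto_lintegral_of_tail_decomposition (fun r hr => ?_) ?_ hh hhfin
    (ENNReal.ofReal_ne_top (r := 2 ^ p)) hC' hC'' fun r hr M => ?_
  · exact (((aestronglyMeasurable_comp_radius hf.1 ⟨by linarith [hr.1], hr.2⟩).sub
      hgm).norm.aemeasurable.pow_const p).ennreal_ofReal
  · filter_upwards [hrad] with ω hω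
    have h1 := ((hω.sub_const (g ω)).norm.rpow_const (Or.inr hp.le) : Tendsto _ _ (𝓝 _))
    rw [sub_self, norm_zero, Real.zero_rpow hp.ne'] at h1
    simpa using ENNReal.tendsto_ofReal h1
  · obtain ⟨G, hG, hGint⟩ := hdec r hr M
    refine ⟨G, ?_, hGint⟩
    filter_upwards [ae_mem_unitSphere n] with ω hω
    refine (ofReal_norm_sub_rpow_le hp _ _).trans ?_
    gcongr
    exact hG ω hω

end
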